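/- For every κ ∈ {1,…,N−1}, the set of initial data x̄ ∈ (ℝ^n)^N from which there exist more than one Krasovsky solution of the topological bounded-confidence model ẋ = f^t(x) (i.e., two Krasovsky solutions starting at x̄ that differ at some time in a common interval of definition) has zero Lebesgue measure in ℝ^{nN}. -/

import Mathlib

open MeasureTheory Set Filter
open scoped Pointwise

noncomputable section

/-- The state space of `N` agents with opinions in `ℝ^n`. -/
abbrev St (n N : ℕ) := Fin N → EuclideanSpace ℝ (Fin n)

/-- The Krasovsky multifunction of a vector field `g`:
`K g (x) = ⋂_{δ>0} closure (convexHull (g '' B(x,δ)))`. -/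
def krasovsky {E : Type*} [NormedAddCommGroup E] [NormedSpace ℝ E] (g : E → E) (x : E) :
    Set E :=
  ⋂ δ > (0:ℝ), closure (convexHull ℝ (g '' Metric.ball x δ))

/-- Krasovsky solution of `ẋ = g(x)` on the set `D`: an absolutely continuous curve
(written in integral form) whose a.e. derivative `v` satisfies `v(s) ∈ K g (x(s))`. -/
def IsKrasovskySolutionOn {E : Type*} [NormedAddCommGroup E] [NormedSpace ℝ E]
    [CompleteSpace E] (g : E → E) (x : ℝ → E) (D : Set ℝ) : Prop :=
  ∃ v : ℝ → E, LocallyIntegrableOn v D ∧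
    (∀ t ∈ D, x t = x 0 + ∫ s in Ioc (0:ℝ) t, v s) ∧
    (∀ᵐ s ∂(volume.restrict D), v s ∈ krasovsky g (x s))

/-- The set of the first `κ` elements of `{1,…,N} \ {i}` ordered by increasing distance
`‖x_j - x_i‖`, ties broken in favour of lower indices: `j` belongs to the set iff the
number of agents `k ≠ i` strictly preceding `j` in this order is `< κ`. -/
def topoNbrs {n N : ℕ} (κ : ℕ) (x : St n N) (i : Fin N) : Finset (Fin N) :=
  Finset.univ.filter fun j => j ≠ i ∧
    (Finset.univ.filter fun k => k ≠ i ∧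
      (‖x k - x i‖ < ‖x j - x i‖ ∨ (‖x k - x i‖ = ‖x j - x i‖ ∧ k < j))).card < κ

/-- The topological bounded-confidence vector field:
`fᵗᵢ(x) = Σ_{j ∈ Nᵢᵗ(x)} a(‖x_j - x_i‖)(x_j - x_i)`. -/
def ft {n N : ℕ} (a : ℝ → ℝ) (κ : ℕ) (x : St n N) : St n N :=
  fun i => ∑ j ∈ topoNbrs κ x i, a ‖x j - x i‖ • (x j - x i)

open scoped Topology NNReal ENNReal

/-! ### Nearest-neighbour sets -/

/-- `S` is a set of `κ` agents that are nearest to `i`, ties being broken arbitrarily. -/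
def IsNbrSet {n N : ℕ} (κ : ℕ) (x : St n N) (i : Fin N) (S : Finset (Fin N)) : Prop :=
  i ∉ S ∧ S.card = κ ∧ ∀ j ∈ S, ∀ k, k ∉ S → k ≠ i → ‖x j - x i‖ ≤ ‖x k - x i‖

/-- `σ` chooses a nearest-neighbour set for every agent. -/
def IsSel {n N : ℕ} (κ : ℕ) (x : St n N) (σ : Fin N → Finset (Fin N)) : Prop :=
  ∀ i, IsNbrSet κ x i (σ i)

/-- The interaction field with prescribed neighbours. -/
def frozen {n N : ℕ} (a : ℝ → ℝ) (σ : Fin N → Finset (Fin N)) (x : St n N) : St n N :=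
  fun i => ∑ j ∈ σ i, a ‖x j - x i‖ • (x j - x i)

lemma card_filter_rank_lt {α : Type*} [LinearOrder α] (κ : ℕ) (T : Finset α) :
    (T.filter fun t => (T.filter fun u => u < t).card < κ).card = min κ T.card := by
  classical
  induction T using Finset.induction_on_max with
  | empty => simp
  | insert m s hm ih =>
    have hms : m ∉ s := fun h => lt_irrefl _ (hm m h)
    have h1 : ∀ t ∈ s, ((insert m s).filter fun u => u < t) = s.filter fun u => u < t := by
      intro t ht
      rw [Finset.filter_insert, if_neg (not_lt.2 (hm t ht).le)]
    have h2 : ((insert m s).filter fun u => u < m) = s := by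
      rw [Finset.filter_insert, if_neg (lt_irrefl _)]
      exact Finset.filter_true_of_mem hm
    have h3 : (s.filter fun t => ((insert m s).filter fun u => u < t).card < κ)
        = s.filter fun t => (s.filter fun u => u < t).card < κ := by
      refine Finset.filter_congr fun t ht => ?_
      rw [h1 t ht]
    rw [Finset.filter_insert, h2, h3, Finset.card_insert_of_notMem hms]
    split_ifs with h
    · rw [Finset.card_insert_of_notMem (by simp [hms]), ih]
      omega
    · rw [ih]
      omega

lemma card_topoNbrs {n N κ : ℕ} (hκ : κ ≤ N - 1) (x : St n N) (i : Fin N) :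
    (topoNbrs κ x i).card = κ := by
  classical
  let e : Fin N → ℝ ×ₗ Fin N := fun j => toLex (‖x j - x i‖, j)
  have he : Function.Injective e := by
    intro j k h
    have h' := congrArg ofLex h
    exact (Prod.mk.inj h').2
  have helt : ∀ k j, e k < e j ↔
      (‖x k - x i‖ < ‖x j - x i‖ ∨ (‖x k - x i‖ = ‖x j - x i‖ ∧ k < j)) := by
    intro k j
    simp only [e, Prod.Lex.toLex_lt_toLex]
  have hc := card_filter_rank_lt κ ((Finset.univ.erase i).image e)
  rw [Finset.card_image_of_injective _ he, Finset.card_erase_of_mem (Finset.mem_univ i),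
    Finset.card_univ, Fintype.card_fin, min_eq_left hκ] at hc
  refine Eq.trans ?_ hc
  rw [← Finset.card_image_of_injective _ he, Finset.filter_image, topoNbrs]
  congr 2
  ext j
  simp only [Finset.mem_filter, Finset.mem_univ, true_and, Finset.mem_erase, and_true]
  refine and_congr_right fun _ => ?_
  rw [Finset.filter_image, Finset.card_image_of_injective _ he]
  have : (Finset.univ.filter fun k => k ≠ i ∧
      (‖x k - x i‖ < ‖x j - x i‖ ∨ (‖x k - x i‖ = ‖x j - x i‖ ∧ k < j)))
      = (Finset.univ.erase i).filter fun k => e k < e j := by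
    ext k
    simp [helt]
  rw [this]

lemma isNbrSet_topoNbrs {n N κ : ℕ} (hκ : κ ≤ N - 1) (x : St n N) (i : Fin N) :
    IsNbrSet κ x i (topoNbrs κ x i) := by
  classical
  refine ⟨by simp [topoNbrs], card_topoNbrs hκ x i, ?_⟩
  intro j hj k hk hki
  by_contra! hlt
  apply hk
  simp only [topoNbrs, Finset.mem_filter, Finset.mem_univ, true_and] at hj ⊢
  refine ⟨hki, lt_of_le_of_lt (Finset.card_le_card ?_) hj.2⟩
  intro l hl
  simp only [Finset.mem_filter, Finset.mem_univ, true_and] at hl ⊢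
  refine ⟨hl.1, Or.inl ?_⟩
  rcases hl.2 with h | h
  · exact h.trans hlt
  · exact h.1 ▸ hlt

lemma ft_eq_frozen {n N : ℕ} (a : ℝ → ℝ) (κ : ℕ) (x : St n N) :
    ft a κ x = frozen a (topoNbrs κ x) x := rfl

/-- Nearest-neighbour sets are upper semicontinuous in the configuration. -/
lemma eventually_isNbrSet_imp {n N κ : ℕ} (p : St n N) (i : Fin N) :
    ∀ᶠ y in 𝓝 p, ∀ S, IsNbrSet κ y i S → IsNbrSet κ p i S := by
  rw [eventually_all]
  intro S
  by_cases hS : IsNbrSet κ p i S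
  · exact Eventually.of_forall fun _ _ => hS
  by_cases h1 : i ∉ S ∧ S.card = κ
  · have : ∃ j ∈ S, ∃ k, k ∉ S ∧ k ≠ i ∧ ‖p k - p i‖ < ‖p j - p i‖ := by
      by_contra! h
      exact hS ⟨h1.1, h1.2, fun j hj k hk hki => h j hj k hk hki⟩
    obtain ⟨j, hj, k, hk, hki, hlt⟩ := this
    have hc1 : Continuous fun y : St n N => ‖y k - y i‖ := by fun_prop
    have hc2 : Continuous fun y : St n N => ‖y j - y i‖ := by fun_prop
    filter_upwards [hc1.continuousAt.eventually_lt hc2.continuousAt hlt] with y hy hyS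
    exact absurd (hyS.2.2 j hj k hk hki) (not_le.2 hy)
  · exact Eventually.of_forall fun y hy => absurd ⟨hy.1, hy.2.1⟩ h1

lemma eventually_isSel_imp {n N κ : ℕ} (p : St n N) :
    ∀ᶠ y in 𝓝 p, ∀ σ, IsSel κ y σ → IsSel κ p σ := by
  filter_upwards [eventually_all.2 fun i => eventually_isNbrSet_imp (κ := κ) p i] with y hy σ hσ i
  exact hy i _ (hσ i)

/-- Two different nearest-neighbour sets exchange equidistant agents. -/
lemma IsNbrSet.tie {n N κ : ℕ} {x : St n N} {i : Fin N} {S S' : Finset (Fin N)}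
    (hS : IsNbrSet κ x i S) (hS' : IsNbrSet κ x i S') {j k : Fin N} (hj : j ∈ S) (hj' : j ∉ S')
    (hk : k ∈ S') (hk' : k ∉ S) :
    j ≠ i ∧ k ≠ i ∧ j ≠ k ∧ ‖x j - x i‖ = ‖x k - x i‖ := by
  have hji : j ≠ i := fun h => hS.1 (h ▸ hj)
  have hki : k ≠ i := fun h => hS'.1 (h ▸ hk)
  exact ⟨hji, hki, fun h => hk' (h ▸ hj),
    le_antisymm (hS.2.2 j hj k hk' hki) (hS'.2.2 k hk j hj' hji)⟩

lemma exists_mem_sdiff_of_card_eq {α : Type*} [DecidableEq α] {S S' : Finset α}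
    (hc : S.card = S'.card) (hne : S ≠ S') :
    (∃ j ∈ S, j ∉ S') ∧ ∃ k ∈ S', k ∉ S := by
  constructor
  · by_contra! h
    exact hne (Finset.eq_of_subset_of_card_le h hc.ge)
  · by_contra! h
    exact hne (Finset.eq_of_subset_of_card_le h hc.le).symm

/-! ### One-sided estimates for the interaction -/

/-- A set consisting of minimal values of `d` has the smallest sum among sets of its size. -/
lemma sum_le_sum_of_initial {α : Type*} [DecidableEq α] {S S' : Finset α} (d : α → ℝ)
    (hc : S.card = S'.card) (h : ∀ j ∈ S, ∀ k ∈ S', k ∉ S → d j ≤ d k) :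
    ∑ j ∈ S, d j ≤ ∑ j ∈ S', d j := by
  have key : ∑ j ∈ S \ S', d j ≤ ∑ j ∈ S' \ S, d j := by
    rcases (S \ S').eq_empty_or_nonempty with he | hne
    · have : S = S' := Finset.eq_of_subset_of_card_le (Finset.sdiff_eq_empty_iff_subset.1 he) hc.ge
      simp [this]
    · obtain ⟨m, hm, hmax⟩ := Finset.exists_max_image (S \ S') d hne
      have hcard : (S \ S').card = (S' \ S).card := Finset.card_sdiff_comm hc
      calc ∑ j ∈ S \ S', d j ≤ (S \ S').card • d m := Finset.sum_le_card_nsmul _ _ _ hmax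
        _ = (S' \ S).card • d m := by rw [hcard]
        _ ≤ ∑ j ∈ S' \ S, d j := by
          refine Finset.card_nsmul_le_sum _ _ _ fun k hk => ?_
          exact h m (Finset.mem_sdiff.1 hm).1 k (Finset.mem_sdiff.1 hk).1 (Finset.mem_sdiff.1 hk).2
  have := Finset.sum_sdiff_sub_sum_sdiff (s₁ := S) (s₂ := S') (f := d)
  linarith

/-- The radial potential of the interaction. -/
def radialPotential (a : ℝ → ℝ) (r : ℝ) : ℝ := ∫ s in (0 : ℝ)..r, a s * s

lemma radialPotential_sub {a : ℝ → ℝ} (ha : Continuous a) (r r' : ℝ) :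
    radialPotential a r' - radialPotential a r = ∫ s in r..r', a s * s := by
  have hi : ∀ u v : ℝ, IntervalIntegrable (fun s => a s * s) volume u v :=
    fun u v => (ha.mul continuous_id).intervalIntegrable u v
  rw [radialPotential, radialPotential, intervalIntegral.integral_interval_sub_left (hi _ _) (hi _ _)]

lemma radialPotential_mono {a : ℝ → ℝ} (ha : Continuous a) (ha0 : ∀ r, 0 ≤ a r) {r r' : ℝ}
    (hr : 0 ≤ r) (h : r ≤ r') : radialPotential a r ≤ radialPotential a r' := by
  have := radialPotential_sub ha r r'
  have h2 : 0 ≤ ∫ s in r..r', a s * s :=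
    intervalIntegral.integral_nonneg h fun s hs => mul_nonneg (ha0 s) (hr.trans hs.1)
  linarith

lemma abs_radialPotential_sub_le {a : ℝ → ℝ} {K : ℝ≥0} (ha : LipschitzWith K a) {R r r' : ℝ}
    (hr : 0 ≤ r) (hr' : 0 ≤ r') (hR : r ≤ R) (hR' : r' ≤ R) :
    |radialPotential a r' - radialPotential a r - a r * ((r' ^ 2 - r ^ 2) / 2)|
      ≤ K * R * (r' - r) ^ 2 := by
  have hi : ∀ u v : ℝ, IntervalIntegrable (fun s => a s * s) volume u v :=
    fun u v => (ha.continuous.mul continuous_id).intervalIntegrable u v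
  have hi2 : ∀ u v : ℝ, IntervalIntegrable (fun s => a r * s) volume u v :=
    fun u v => (continuous_const.mul continuous_id).intervalIntegrable u v
  have h1 : a r * ((r' ^ 2 - r ^ 2) / 2) = ∫ s in r..r', a r * s := by
    rw [intervalIntegral.integral_const_mul, integral_id]
  rw [radialPotential_sub ha.continuous, h1, ← intervalIntegral.integral_sub (hi _ _) (hi2 _ _)]
  have hb : ∀ s ∈ Set.uIoc r r', ‖a s * s - a r * s‖ ≤ K * |r' - r| * R := by
    intro s hs
    have hs' := Set.uIoc_subset_uIcc hs
    have hd : |s - r| ≤ |r' - r| := Set.abs_sub_left_of_mem_uIcc hs'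
    have hs0 : 0 ≤ s := by
      rcases Set.mem_uIcc.1 hs' with h | h
      · linarith [h.1]
      · linarith [h.1]
    have hsR : s ≤ R := by
      rcases Set.mem_uIcc.1 hs' with h | h
      · linarith [h.2]
      · linarith [h.2]
    have hl : |a s - a r| ≤ K * |s - r| := by
      have := ha.dist_le_mul s r
      rwa [Real.dist_eq, Real.dist_eq] at this
    rw [← sub_mul, norm_mul, Real.norm_eq_abs, Real.norm_eq_abs, abs_of_nonneg hs0]
    have hK : (0 : ℝ) ≤ K := K.2
    gcongr
    exact hl.trans (by gcongr)
  have := intervalIntegral.norm_integral_le_of_norm_le_const hb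
  rw [Real.norm_eq_abs] at this
  refine this.trans (le_of_eq ?_)
  rw [← sq_abs (r' - r)]
  ring

/-- The interaction force as a function of the relative position. -/
def force {V : Type*} [NormedAddCommGroup V] [InnerProductSpace ℝ V] (a : ℝ → ℝ) (v : V) : V :=
  a ‖v‖ • v

section Force

variable {V : Type*} [NormedAddCommGroup V] [InnerProductSpace ℝ V]

lemma radialPotential_expansion {a : ℝ → ℝ} {K : ℝ≥0} (ha : LipschitzWith K a)
    {R A : ℝ} (hA : ∀ r, 0 ≤ r → r ≤ R → |a r| ≤ A) (y P Q : V)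
    (hP : ‖y - P‖ ≤ R) (hQ : ‖y - Q‖ ≤ R) :
    |radialPotential a ‖y - Q‖ - radialPotential a ‖y - P‖ + inner ℝ (force a (y - P)) (Q - P)|
      ≤ (K * R + A) * ‖Q - P‖ ^ 2 := by
  have h1 := abs_radialPotential_sub_le ha (norm_nonneg (y - P)) (norm_nonneg (y - Q)) hP hQ
  have hA' := hA _ (norm_nonneg (y - P)) hP
  have hn : ‖y - Q‖ ^ 2 - ‖y - P‖ ^ 2 = -2 * inner ℝ (y - P) (Q - P) + ‖Q - P‖ ^ 2 := by
    have : y - Q = (y - P) - (Q - P) := by abel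
    rw [this, norm_sub_sq_real]
    ring
  have hd : (‖y - Q‖ - ‖y - P‖) ^ 2 ≤ ‖Q - P‖ ^ 2 := by
    rw [sq_le_sq, abs_of_nonneg (norm_nonneg (Q - P))]
    refine (abs_norm_sub_norm_le _ _).trans (le_of_eq ?_)
    rw [sub_sub_sub_cancel_left, norm_sub_rev]
  have hR : 0 ≤ R := (norm_nonneg _).trans hP
  have hKR : 0 ≤ (K : ℝ) * R := mul_nonneg K.2 hR
  rw [force, real_inner_smul_left]
  rw [hn] at h1
  have h2 := mul_le_mul_of_nonneg_left hd hKR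
  have h3 : |a ‖y - P‖| * ‖Q - P‖ ^ 2 ≤ A * ‖Q - P‖ ^ 2 := by gcongr
  have h4 : |a ‖y - P‖ * ‖Q - P‖ ^ 2| = |a ‖y - P‖| * ‖Q - P‖ ^ 2 := by
    rw [abs_mul, abs_of_nonneg (sq_nonneg ‖Q - P‖)]
  have h5 : 0 ≤ |a ‖y - P‖| * ‖Q - P‖ ^ 2 := by positivity
  have h6 := abs_le.1 h1
  have h7 := abs_le.1 h4.le
  rw [abs_le]
  constructor <;> nlinarith [h6.1, h6.2, h7.1, h7.2]

/-- One-sided Lipschitz bound for the sum of the forces of nearest points. -/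
lemma inner_sum_force_sub_ge {a : ℝ → ℝ} {K : ℝ≥0} (ha : LipschitzWith K a)
    (ha0 : ∀ r, 0 ≤ a r) {R A : ℝ} (hA : ∀ r, 0 ≤ r → r ≤ R → |a r| ≤ A) {ι : Type*}
    [Fintype ι] [DecidableEq ι] (y : ι → V) (P Q : V) (hP : ∀ l, ‖y l - P‖ ≤ R)
    (hQ : ∀ l, ‖y l - Q‖ ≤ R) (S S' : Finset ι) (hc : S.card = S'.card)
    (hS : ∀ j ∈ S, ∀ k ∈ S', k ∉ S → ‖y j - P‖ ≤ ‖y k - P‖)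
    (hS' : ∀ j ∈ S', ∀ k ∈ S, k ∉ S' → ‖y j - Q‖ ≤ ‖y k - Q‖) :
    -(2 * Fintype.card ι * (K * R + A)) * ‖Q - P‖ ^ 2
      ≤ inner ℝ (∑ l ∈ S', force a (y l - Q) - ∑ l ∈ S, force a (y l - P)) (Q - P) := by
  set B := (K * R + A) * ‖Q - P‖ ^ 2 with hB
  have hc' := ha.continuous
  have e1 : ∑ l ∈ S, radialPotential a ‖y l - P‖ ≤ ∑ l ∈ S', radialPotential a ‖y l - P‖ :=
    sum_le_sum_of_initial _ hc fun j hj k hk hk' =>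
      radialPotential_mono hc' ha0 (norm_nonneg _) (hS j hj k hk hk')
  have e2 : ∑ l ∈ S', radialPotential a ‖y l - Q‖ ≤ ∑ l ∈ S, radialPotential a ‖y l - Q‖ :=
    sum_le_sum_of_initial _ hc.symm fun j hj k hk hk' =>
      radialPotential_mono hc' ha0 (norm_nonneg _) (hS' j hj k hk hk')
  have hB0 : ∀ T : Finset ι, T.Nonempty → 0 ≤ B := by
    rintro T ⟨l, -⟩
    exact (abs_nonneg _).trans (radialPotential_expansion ha hA (y l) P Q (hP l) (hQ l))
  have hcard : ∀ T : Finset ι, T.card • B ≤ Fintype.card ι * B := by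
    intro T
    rcases T.eq_empty_or_nonempty with h | h
    · by_cases hι : Nonempty ι
      · have := hB0 {hι.some} (by simp)
        rw [h]
        simp only [Finset.card_empty, zero_smul]
        positivity
      · rw [h]
        have := not_nonempty_iff.1 hι
        simp
    · rw [nsmul_eq_mul]
      exact mul_le_mul_of_nonneg_right (by exact_mod_cast T.card_le_univ) (hB0 T h)
  have e3 : ∑ l ∈ S, (radialPotential a ‖y l - Q‖ - radialPotential a ‖y l - P‖
      + inner ℝ (force a (y l - P)) (Q - P)) ≤ S.card • B :=
    Finset.sum_le_card_nsmul _ _ _ fun l _ =>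
      (abs_le.1 (radialPotential_expansion ha hA (y l) P Q (hP l) (hQ l))).2
  have e4 : ∑ l ∈ S', (radialPotential a ‖y l - P‖ - radialPotential a ‖y l - Q‖
      + inner ℝ (force a (y l - Q)) (P - Q)) ≤ S'.card • B := by
    refine Finset.sum_le_card_nsmul _ _ _ fun l _ => ?_
    have := (abs_le.1 (radialPotential_expansion ha hA (y l) Q P (hQ l) (hP l))).2
    rwa [norm_sub_rev P Q] at this
  have e5 := hcard S
  have e6 := hcard S'
  have hPQ : ∀ v : V, inner ℝ v (P - Q) = -inner ℝ v (Q - P) := by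
    intro v
    rw [← inner_neg_right, neg_sub]
  simp only [hPQ, Finset.sum_add_distrib, Finset.sum_sub_distrib, Finset.sum_neg_distrib] at e3 e4
  rw [inner_sub_left, sum_inner, sum_inner]
  have : -(2 * Fintype.card ι * (K * R + A)) * ‖Q - P‖ ^ 2 = -(2 * (Fintype.card ι * B)) := by
    rw [hB]; ring
  rw [this]
  linarith

end Force

/-! ### Measure estimates for expanding maps -/

lemma hausdorffMeasure_le_of_expanding {X Y : Type*} [EMetricSpace X] [EMetricSpace Y]
    [MeasurableSpace X] [BorelSpace X] [MeasurableSpace Y] [BorelSpace Y] {D : ℝ≥0} {d : ℝ}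
    (hd : 0 ≤ d) {s : Set X} {t : Set Y} {φ : X → Y} (hφ : MapsTo φ s t)
    (hexp : ∀ x ∈ s, ∀ y ∈ s, edist x y ≤ D * edist (φ x) (φ y)) :
    μH[d] s ≤ (D : ℝ≥0∞) ^ d * μH[d] t := by
  rcases s.eq_empty_or_nonempty with rfl | ⟨x₀, hx₀⟩
  · simp
  have : Nonempty X := ⟨x₀⟩
  have hinj : InjOn φ s := by
    intro x hx y hy h
    have := hexp x hx y hy
    rw [h, edist_self, mul_zero] at this
    exact edist_le_zero.1 this
  let g := Function.invFunOn φ s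
  have hg : ∀ x ∈ s, g (φ x) = x := fun x hx => hinj.leftInvOn_invFunOn hx
  have hlip : LipschitzOnWith D g (φ '' s) := by
    rintro _ ⟨x, hx, rfl⟩ _ ⟨y, hy, rfl⟩
    rw [hg x hx, hg y hy]
    exact hexp x hx y hy
  have himg : g '' (φ '' s) = s := by
    rw [image_image]
    exact (image_congr hg).trans (image_id' s)
  calc μH[d] s = μH[d] (g '' (φ '' s)) := by rw [himg]
    _ ≤ (D : ℝ≥0∞) ^ d * μH[d] (φ '' s) := hlip.hausdorffMeasure_image_le hd
    _ ≤ (D : ℝ≥0∞) ^ d * μH[d] t := by gcongr; exact hφ.image_subset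

lemma addHaar_eq_smul_hausdorffMeasure {E : Type*} [NormedAddCommGroup E] [NormedSpace ℝ E]
    [FiniteDimensional ℝ E] [MeasurableSpace E] [BorelSpace E] (μ : Measure E)
    [μ.IsAddHaarMeasure] :
    ∃ c : ℝ≥0, c ≠ 0 ∧ μ = c • (μH[(Module.finrank ℝ E : ℝ)] : Measure E) := by
  have := isAddHaarMeasure_hausdorffMeasure (E := E)
  refine ⟨Measure.addHaarScalarFactor μ μH[(Module.finrank ℝ E : ℝ)], ?_, ?_⟩
  · exact (Measure.addHaarScalarFactor_pos_of_isAddHaarMeasure _ _).ne'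
  · exact Measure.isAddLeftInvariant_eq_smul _ _

lemma addHaar_le_of_expanding {E : Type*} [NormedAddCommGroup E] [NormedSpace ℝ E]
    [FiniteDimensional ℝ E] [MeasurableSpace E] [BorelSpace E] (μ : Measure E)
    [μ.IsAddHaarMeasure] {D : ℝ≥0} {s t : Set E} {φ : E → E} (hφ : MapsTo φ s t)
    (hexp : ∀ x ∈ s, ∀ y ∈ s, edist x y ≤ D * edist (φ x) (φ y)) :
    μ s ≤ (D : ℝ≥0∞) ^ Module.finrank ℝ E * μ t := by
  obtain ⟨c, -, hc⟩ := addHaar_eq_smul_hausdorffMeasure μ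
  have h := hausdorffMeasure_le_of_expanding (d := (Module.finrank ℝ E : ℝ)) (by positivity) hφ hexp
  rw [ENNReal.rpow_natCast] at h
  rw [hc]
  simp only [Measure.smul_apply, ENNReal.smul_def, smul_eq_mul]
  calc (c : ℝ≥0∞) * μH[(Module.finrank ℝ E : ℝ)] s
      ≤ c * ((D : ℝ≥0∞) ^ Module.finrank ℝ E * μH[(Module.finrank ℝ E : ℝ)] t) := by gcongr
    _ = _ := by ring

lemma exists_addHaar_le_of_expanding {E F : Type*} [NormedAddCommGroup E] [NormedSpace ℝ E]
    [FiniteDimensional ℝ E] [MeasurableSpace E] [BorelSpace E] (μ : Measure E)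
    [μ.IsAddHaarMeasure] [NormedAddCommGroup F] [NormedSpace ℝ F]
    [FiniteDimensional ℝ F] [MeasurableSpace F] [BorelSpace F] (ν : Measure F)
    [ν.IsAddHaarMeasure] (hd : Module.finrank ℝ E = Module.finrank ℝ F) {D : ℝ≥0} {s : Set E}
    {φ : E → F} (hexp : ∀ x ∈ s, ∀ y ∈ s, edist x y ≤ D * edist (φ x) (φ y)) :
    ∃ C : ℝ≥0, ∀ u ⊆ s, ∀ t : Set F, MapsTo φ u t → μ u ≤ C * ν t := by
  obtain ⟨c, -, hc⟩ := addHaar_eq_smul_hausdorffMeasure μ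
  obtain ⟨c', hc'0, hc'⟩ := addHaar_eq_smul_hausdorffMeasure ν
  refine ⟨c * D ^ Module.finrank ℝ E * c'⁻¹, fun u hu t hφ => ?_⟩
  have h := hausdorffMeasure_le_of_expanding (d := (Module.finrank ℝ E : ℝ)) (by positivity) hφ
    fun x hx y hy => hexp x (hu hx) y (hu hy)
  rw [ENNReal.rpow_natCast] at h
  rw [hc, hc', ← hd]
  simp only [Measure.smul_apply, ENNReal.smul_def, smul_eq_mul]
  calc (c : ℝ≥0∞) * μH[(Module.finrank ℝ E : ℝ)] u
      ≤ c * ((D : ℝ≥0∞) ^ Module.finrank ℝ E * μH[(Module.finrank ℝ E : ℝ)] t) := by gcongr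
    _ = c * D ^ Module.finrank ℝ E * (((c'⁻¹ : ℝ≥0) : ℝ≥0∞) * c') * μH[(Module.finrank ℝ E : ℝ)] t := by
        rw [← ENNReal.coe_mul, inv_mul_cancel₀ hc'0, ENNReal.coe_one]; ring
    _ = _ := by
        rw [ENNReal.coe_mul, ENNReal.coe_mul, ENNReal.coe_pow]; ring

/-- A map of a product moving only the coordinate `i`, and expanding in this coordinate,
does not shrink volumes by much. -/
lemma volume_le_of_update_expanding {n N : ℕ} {D : ℝ≥0} (i : Fin N) {S W : Set (St n N)}
    (hS : MeasurableSet S) (hW : MeasurableSet W)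
    (γ : St n N → EuclideanSpace ℝ (Fin n))
    (hγ : ∀ x ∈ S, Function.update x i (γ x) ∈ W)
    (hexp : ∀ x z z', Function.update x i z ∈ S → Function.update x i z' ∈ S →
      edist z z' ≤ D * edist (γ (Function.update x i z)) (γ (Function.update x i z'))) :
    volume S ≤ (D : ℝ≥0∞) ^ n * volume W := by
  classical
  have h1 := lintegral_le_of_lmarginal_le
    (μ := fun _ : Fin N => (volume : Measure (EuclideanSpace ℝ (Fin n)))) {i}
    (f := S.indicator 1) (g := fun x => (D : ℝ≥0∞) ^ n * W.indicator 1 x)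
    (measurable_one.indicator hS) ((measurable_one.indicator hW).const_mul _) ?_
  · rw [lintegral_const_mul _ (measurable_one.indicator hW), lintegral_indicator_one hS,
      lintegral_indicator_one hW] at h1
    exact h1
  · rw [lmarginal_singleton, lmarginal_singleton]
    intro x
    have hup : Measurable fun z : EuclideanSpace ℝ (Fin n) => Function.update x i z :=
      measurable_update x
    have e : ∀ T : Set (St n N), (fun z => T.indicator (1 : St n N → ℝ≥0∞) (Function.update x i z))
        = ((fun z => Function.update x i z) ⁻¹' T).indicator 1 := by
      intro T
      ext z
      simp [indicator]
    dsimp only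
    have e' := lintegral_const_mul (μ := (volume : Measure (EuclideanSpace ℝ (Fin n))))
      ((D : ℝ≥0∞) ^ n) (f := fun z => W.indicator (1 : St n N → ℝ≥0∞) (Function.update x i z))
      ((measurable_one.indicator hW).comp hup)
    rw [e', e S, e W,
      lintegral_indicator_one (hup hS), lintegral_indicator_one (hup hW)]
    have := addHaar_le_of_expanding (volume : Measure (EuclideanSpace ℝ (Fin n)))
      (D := D) (s := (fun z => Function.update x i z) ⁻¹' S)
      (t := (fun z => Function.update x i z) ⁻¹' W) (φ := fun z => γ (Function.update x i z))
      (fun z hz => by simpa using hγ _ hz) (fun z hz z' hz' => hexp x z z' hz hz')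
    simpa using this

/-! ### The interaction field on bounded sets -/

lemma measurable_ft {n N : ℕ} {a : ℝ → ℝ} (ha : Continuous a) (κ : ℕ) :
    Measurable (ft a κ : St n N → St n N) := by
  classical
  refine measurable_pi_lambda _ fun i => ?_
  have hm : ∀ j, MeasurableSet {x : St n N | j ∈ topoNbrs κ x i} := by
    intro j
    simp only [topoNbrs, Finset.mem_filter, Finset.mem_univ, true_and]
    refine (MeasurableSet.const (j ≠ i)).inter ?_
    simp only [Finset.card_filter]
    refine measurableSet_lt (α := ℕ) ?_ measurable_const
    refine Finset.measurable_fun_sum (M := ℕ) _ fun k _ => ?_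
    refine Measurable.ite ?_ measurable_const measurable_const
    have hc : ∀ k : Fin N, Measurable fun x : St n N => ‖x k - x i‖ := fun k =>
      (by fun_prop : Continuous fun x : St n N => ‖x k - x i‖).measurable
    exact (MeasurableSet.const (k ≠ i)).inter ((measurableSet_lt (hc k) (hc j)).union
      ((measurableSet_eq_fun (hc k) (hc j)).inter (MeasurableSet.const (k < j))))
  have : (fun x : St n N => ft a κ x i) = fun x => ∑ j, if j ∈ topoNbrs κ x i then
      a ‖x j - x i‖ • (x j - x i) else 0 := by
    ext1 x
    rw [ft, Finset.sum_ite_mem, Finset.univ_inter]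
  rw [this]
  refine Finset.measurable_fun_sum _ fun j _ => Measurable.ite (hm j) ?_ measurable_const
  exact (by fun_prop : Continuous fun x : St n N => a ‖x j - x i‖ • (x j - x i)).measurable

lemma continuous_frozen {n N : ℕ} {a : ℝ → ℝ} (ha : Continuous a)
    (σ : Fin N → Finset (Fin N)) : Continuous (frozen a σ : St n N → St n N) := by
  unfold frozen
  fun_prop

lemma exists_frozen_bound {n N : ℕ} {a : ℝ → ℝ} (ha : Continuous a) (M : ℝ) :
    ∃ L : ℝ, 0 ≤ L ∧ ∀ σ, ∀ x : St n N, ‖x‖ ≤ M → ‖frozen a σ x‖ ≤ L := by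
  have : ∀ σ : Fin N → Finset (Fin N), ∃ L : ℝ, ∀ x : St n N, ‖x‖ ≤ M → ‖frozen a σ x‖ ≤ L := by
    intro σ
    obtain ⟨L, hL⟩ := (isCompact_closedBall (0 : St n N) M).exists_bound_of_continuousOn
      (continuous_frozen ha σ).continuousOn
    exact ⟨L, fun x hx => hL x (by simpa using hx)⟩
  choose L hL using this
  refine ⟨∑ σ, |L σ|, by positivity, fun σ x hx => (hL σ x hx).trans ?_⟩
  exact (le_abs_self _).trans
    (Finset.single_le_sum (f := fun σ => |L σ|) (fun _ _ => abs_nonneg _) (Finset.mem_univ σ))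

lemma exists_kernel_bound {a : ℝ → ℝ} (ha : Continuous a) (R : ℝ) :
    ∃ A : ℝ, 0 ≤ A ∧ ∀ r, 0 ≤ r → r ≤ R → |a r| ≤ A := by
  obtain ⟨A, hA⟩ := (isCompact_Icc (a := (0 : ℝ)) (b := R)).exists_bound_of_continuousOn
    ha.continuousOn
  refine ⟨max A 0, le_max_right _ _, fun r h0 h1 => ?_⟩
  exact (hA r ⟨h0, h1⟩).trans (le_max_left _ _)

lemma norm_apply_sub_le {n N : ℕ} {x : St n N} {M : ℝ} (hx : ‖x‖ ≤ M) (j k : Fin N) :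
    ‖x j - x k‖ ≤ 2 * M := by
  have h1 := (norm_le_pi_norm x j).trans hx
  have h2 := (norm_le_pi_norm x k).trans hx
  linarith [norm_sub_le (x j) (x k)]

/-- Moving one agent only, its velocity is one-sided Lipschitz from below. -/
lemma exists_inner_ft_update_ge {n N κ : ℕ} (hκ : κ ≤ N - 1) {a : ℝ → ℝ} {K : ℝ≥0}
    (ha : LipschitzWith K a) (ha0 : ∀ r, 0 ≤ a r) (M : ℝ) (hM : 0 ≤ M) :
    ∃ C : ℝ, 0 ≤ C ∧ ∀ (x : St n N) (i : Fin N) (P Q : EuclideanSpace ℝ (Fin n)),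
      ‖Function.update x i P‖ ≤ M → ‖Function.update x i Q‖ ≤ M →
      -C * ‖Q - P‖ ^ 2 ≤ inner ℝ (ft a κ (Function.update x i Q) i
        - ft a κ (Function.update x i P) i) (Q - P) := by
  obtain ⟨A, hA0, hA⟩ := exists_kernel_bound ha.continuous (2 * M)
  refine ⟨2 * Fintype.card (Fin N) * (K * (2 * M) + A), by positivity, fun x i P Q hP hQ => ?_⟩
  set y := Function.update x i P with hy
  set y' := Function.update x i Q with hy'
  have hyi : y i = P := by simp [hy]
  have hyi' : y' i = Q := by simp [hy']
  have hyl : ∀ l, l ≠ i → y' l = y l := by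
    intro l hl
    simp [hy, hy', hl]
  have hT := isNbrSet_topoNbrs hκ y i
  have hT' := isNbrSet_topoNbrs hκ y' i
  have hne : ∀ {S : Finset (Fin N)}, i ∉ S → ∀ {k}, k ∈ S → k ≠ i := by
    intro S hS k hk h
    exact hS (h ▸ hk)
  have key := inner_sum_force_sub_ge ha ha0 hA y P Q (R := 2 * M)
    (fun l => by rw [← hyi]; exact norm_apply_sub_le hP l i)
    (fun l => by
      have h1 := (norm_le_pi_norm y l).trans hP
      have h2 := (norm_le_pi_norm y' i).trans hQ
      rw [hyi'] at h2
      linarith [norm_sub_le (y l) Q])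
    (topoNbrs κ y i) (topoNbrs κ y' i) (hT.2.1.trans hT'.2.1.symm)
    (fun j hj k hk hk' => by
      have := hT.2.2 j hj k hk' (hne hT'.1 hk)
      rwa [hyi] at this)
    (fun j hj k hk hk' => by
      have := hT'.2.2 j hj k hk' (hne hT.1 hk)
      rwa [hyi', hyl j (hne hT'.1 hj), hyl k (hne hT.1 hk)] at this)
  have e1 : ∑ l ∈ topoNbrs κ y i, force a (y l - P) = ft a κ y i := by
    simp only [ft, force, hyi]
  have e2 : ∑ l ∈ topoNbrs κ y' i, force a (y l - Q) = ft a κ y' i := by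
    simp only [ft, force, hyi']
    exact Finset.sum_congr rfl fun l hl => by rw [hyl l (hne hT'.1 hl)]
  rwa [e1, e2] at key

/-! ### Curves following the convexified selections -/

/-- A bounded Lipschitz curve whose velocity lies, in a weak upper semicontinuous sense, in the
convex hull of the fields obtained by freezing nearest-neighbour selections. -/
structure IsSelSol {n N : ℕ} (a : ℝ → ℝ) (κ : ℕ) (M L T : ℝ) (x : ℝ → St n N) : Prop where
  bound : ∀ t ∈ Icc 0 T, ‖x t‖ ≤ M
  lip : ∀ s ∈ Icc 0 T, ∀ t ∈ Icc 0 T, ‖x t - x s‖ ≤ L * |t - s|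
  incl : ∀ t ∈ Icc 0 T, ∀ (Λ : St n N →L[ℝ] ℝ) (c : ℝ),
    (∀ σ, IsSel κ (x t) σ → Λ (frozen a σ (x t)) < c) →
    ∃ δ > 0, ∀ s ∈ Icc 0 T, ∀ s' ∈ Icc 0 T, |s - t| < δ → |s' - t| < δ → s ≤ s' →
      Λ (x s') - Λ (x s) ≤ c * (s' - s)

lemma IsSelSol.continuousOn {n N κ : ℕ} {a : ℝ → ℝ} {M L T : ℝ} {x : ℝ → St n N}
    (h : IsSelSol a κ M L T x) : ContinuousOn x (Icc 0 T) := by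
  have : LipschitzOnWith L.toNNReal x (Icc 0 T) := by
    refine LipschitzOnWith.of_dist_le_mul fun t ht s hs => ?_
    rw [dist_eq_norm, Real.dist_eq]
    exact (h.lip s hs t ht).trans (by gcongr; exact Real.le_coe_toNNReal L)
  exact this.continuousOn

lemma IsSelSol.mono {n N κ : ℕ} {a : ℝ → ℝ} {M L T S : ℝ} {x : ℝ → St n N}
    (h : IsSelSol a κ M L T x) (hS : S ≤ T) : IsSelSol a κ M L S x := by
  have hsub : ∀ {t}, t ∈ Icc 0 S → t ∈ Icc 0 T := fun ht => ⟨ht.1, ht.2.trans hS⟩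
  refine ⟨fun t ht => h.bound t (hsub ht), fun s hs t ht => h.lip s (hsub hs) t (hsub ht),
    fun t ht Λ c hc => ?_⟩
  obtain ⟨δ, hδ, H⟩ := h.incl t (hsub ht) Λ c hc
  exact ⟨δ, hδ, fun s hs s' hs' => H s (hsub hs) s' (hsub hs')⟩

lemma IsSelSol.shift {n N κ : ℕ} {a : ℝ → ℝ} {M L T τ S : ℝ} {x : ℝ → St n N}
    (h : IsSelSol a κ M L T x) (hτ : 0 ≤ τ) (hS : τ + S ≤ T) :
    IsSelSol a κ M L S (fun s => x (τ + s)) := by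
  have hsub : ∀ {t}, t ∈ Icc 0 S → τ + t ∈ Icc 0 T :=
    fun ht => ⟨add_nonneg hτ ht.1, (add_le_add_right ht.2 τ).trans hS⟩
  refine ⟨fun t ht => h.bound _ (hsub ht), fun s hs t ht => ?_, fun t ht Λ c hc => ?_⟩
  · simpa using h.lip _ (hsub hs) _ (hsub ht)
  · obtain ⟨δ, hδ, H⟩ := h.incl _ (hsub ht) Λ c hc
    refine ⟨δ, hδ, fun s hs s' hs' h1 h2 h3 => ?_⟩
    have := H _ (hsub hs) _ (hsub hs') (by simpa using h1) (by simpa using h2) (by simpa using h3)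
    simpa using this

lemma krasovsky_subset {E : Type*} [NormedAddCommGroup E] [NormedSpace ℝ E] {g : E → E} {x : E}
    {δ : ℝ} (hδ : 0 < δ) {C : Set E} (hC : Convex ℝ C) (hC' : IsClosed C)
    (h : ∀ y ∈ Metric.ball x δ, g y ∈ C) : krasovsky g x ⊆ C :=
  (iInter₂_subset δ hδ).trans
    (closure_minimal (convexHull_min (image_subset_iff.2 h) hC) hC')

/-- Near `p`, every linear functional bounded on the frozen selections at `p` is bounded on the
field, even when its components are evaluated at different points. -/
lemma eventually_apply_ft_lt {n N κ : ℕ} (hκ : κ ≤ N - 1) {a : ℝ → ℝ} (ha : Continuous a)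
    (p : St n N) (Λ : St n N →L[ℝ] ℝ) (c : ℝ)
    (hc : ∀ σ, IsSel κ p σ → Λ (frozen a σ p) < c) :
    ∃ ρ > 0, ∀ y : Fin N → St n N, (∀ i, ‖y i - p‖ < ρ) → Λ (fun i => ft a κ (y i) i) < c := by
  have h1 : ∀ᶠ y in 𝓝 p, ∀ i S, IsNbrSet κ y i S → IsNbrSet κ p i S :=
    eventually_all.2 fun i => eventually_isNbrSet_imp p i
  have h2 : ∀ᶠ y in 𝓝 (fun _ : Fin N => p), ∀ σ, IsSel κ p σ →
      Λ (fun i => frozen a σ (y i) i) < c := by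
    refine eventually_all.2 fun σ => ?_
    by_cases hσ : IsSel κ p σ
    · have hcont : Continuous fun y : Fin N → St n N => Λ (fun i => frozen a σ (y i) i) := by
        refine Λ.continuous.comp (continuous_pi fun i => ?_)
        exact (continuous_apply i).comp ((continuous_frozen ha σ).comp (continuous_apply i))
      filter_upwards [hcont.continuousAt.eventually_lt continuousAt_const (hc σ hσ)] with y hy _
      exact hy
    · exact Eventually.of_forall fun _ h => absurd h hσ
  obtain ⟨ρ₁, hρ₁, H₁⟩ := Metric.eventually_nhds_iff.1 h1
  obtain ⟨ρ₂, hρ₂, H₂⟩ := Metric.eventually_nhds_iff.1 h2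
  refine ⟨min ρ₁ ρ₂, lt_min hρ₁ hρ₂, fun y hy => ?_⟩
  have hd : dist y (fun _ => p) < ρ₂ := by
    rw [dist_pi_lt_iff hρ₂]
    exact fun i => by rw [dist_eq_norm]; exact (hy i).trans_le (min_le_right _ _)
  refine H₂ hd (fun i => topoNbrs κ (y i) i) fun i => ?_
  exact H₁ (by rw [dist_eq_norm]; exact (hy i).trans_le (min_le_left _ _)) i _
    (isNbrSet_topoNbrs hκ _ _)

lemma IsKrasovskySolutionOn.continuousOn {n N : ℕ} {g : St n N → St n N} {T : ℝ}
    {x : ℝ → St n N} (h : IsKrasovskySolutionOn g x (Icc 0 T)) : ContinuousOn x (Icc 0 T) := by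
  obtain ⟨v, hv, hx, -⟩ := h
  have hvi : IntegrableOn v (Icc 0 T) := hv.integrableOn_isCompact isCompact_Icc
  exact (continuousOn_const.add (intervalIntegral.continuousOn_primitive hvi)).congr hx

lemma IsKrasovskySolutionOn.isSelSol {n N κ : ℕ} (hκ : κ ≤ N - 1) {a : ℝ → ℝ}
    (ha : Continuous a) {M L T : ℝ} {x : ℝ → St n N}
    (h : IsKrasovskySolutionOn (ft a κ) x (Icc 0 T)) (hM : ∀ t ∈ Icc 0 T, ‖x t‖ ≤ M)
    (hL : ∀ σ, ∀ y : St n N, ‖y‖ ≤ M + 1 → ‖frozen a σ y‖ ≤ L) :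
    IsSelSol a κ M L T x := by
  have hcont := h.continuousOn
  obtain ⟨v, hv, hx, hvK⟩ := h
  have hvi : IntegrableOn v (Icc 0 T) := hv.integrableOn_isCompact isCompact_Icc
  have hint : ∀ s ∈ Icc 0 T, ∀ s' ∈ Icc 0 T, IntervalIntegrable v volume s s' := by
    intro s hs s' hs'
    refine (hvi.mono_set ?_).intervalIntegrable
    exact (convex_Icc (0 : ℝ) T).ordConnected.uIcc_subset hs hs'
  have hsub : ∀ s ∈ Icc 0 T, ∀ s' ∈ Icc 0 T, x s' - x s = ∫ r in s..s', v r := by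
    intro s hs s' hs'
    have h0 : (0 : ℝ) ∈ Icc 0 T := ⟨le_rfl, hs.1.trans hs.2⟩
    rw [hx s hs, hx s' hs', ← intervalIntegral.integral_of_le hs.1,
      ← intervalIntegral.integral_of_le hs'.1, add_sub_add_left_eq_sub,
      intervalIntegral.integral_interval_sub_left (hint _ h0 _ hs') (hint _ h0 _ hs)]
  rw [ae_restrict_iff' measurableSet_Icc] at hvK
  refine ⟨hM, fun s hs t ht => ?_, fun t ht Λ c hc => ?_⟩
  · rw [hsub s hs t ht]
    refine intervalIntegral.norm_integral_le_of_norm_le_const_ae ?_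
    filter_upwards [hvK] with r hr hrs
    have hrI : r ∈ Icc 0 T :=
      (convex_Icc (0 : ℝ) T).ordConnected.uIcc_subset hs ht (uIoc_subset_uIcc hrs)
    have : v r ∈ Metric.closedBall (0 : St n N) L := by
      refine krasovsky_subset one_pos (convex_closedBall _ _) Metric.isClosed_closedBall
        (fun y hy => ?_) (hr hrI)
      rw [mem_closedBall_zero_iff, ft_eq_frozen]
      refine hL _ _ ?_
      have h1 := hM r hrI
      rw [mem_ball_iff_norm] at hy
      linarith [norm_sub_norm_le y (x r)]
    simpa using this
  · obtain ⟨ρ, hρ, H⟩ := eventually_apply_ft_lt hκ ha (x t) Λ c hc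
    obtain ⟨δ, hδ, hδ'⟩ := Metric.continuousOn_iff.1 hcont t ht (ρ / 2) (by positivity)
    refine ⟨δ, hδ, fun s hs s' hs' h1 h2 hss' => ?_⟩
    rw [← map_sub, hsub s hs s' hs', ← ContinuousLinearMap.intervalIntegral_comp_comm _
      (hint s hs s' hs')]
    have hΛ : IntervalIntegrable (fun r => Λ (v r)) volume s s' :=
      ⟨Λ.integrable_comp (hint s hs s' hs').1, Λ.integrable_comp (hint s hs s' hs').2⟩
    have : ∫ r in s..s', Λ (v r) ≤ ∫ _ in s..s', c := by
      refine intervalIntegral.integral_mono_ae_restrict hss' hΛ (by simp) ?_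
      rw [EventuallyLE, ae_restrict_iff' measurableSet_Icc]
      filter_upwards [hvK] with r hr hrs
      have hrI : r ∈ Icc 0 T := ⟨hs.1.trans hrs.1, hrs.2.trans hs'.2⟩
      have hrt : dist r t < δ := by
        rw [Real.dist_eq, abs_lt] at *
        constructor <;> linarith [hrs.1, hrs.2, h1.1, h2.2]
      have hd := hδ' r hrI hrt
      have hmem : v r ∈ {w | Λ w ≤ c} := by
        refine krasovsky_subset (half_pos hρ) (convex_halfSpace_le Λ.isLinear c)
          (isClosed_le Λ.continuous continuous_const) (fun y hy => ?_) (hr hrI)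
        refine (H (fun _ => y) fun _ => ?_).le
        rw [← dist_eq_norm]
        have := Metric.mem_ball.1 hy
        linarith [dist_triangle y (x r) (x t)]
      exact hmem
    rwa [intervalIntegral.integral_const, smul_eq_mul, mul_comm] at this

/-! ### A volume-controlling splitting scheme -/

/-- Explicit Euler step for the agent `i` only. -/
def agentStep {n N : ℕ} (a : ℝ → ℝ) (κ : ℕ) (ε : ℝ) (x : St n N) (i : Fin N) : St n N :=
  Function.update x i (x i + ε • ft a κ x i)

/-- Euler steps for all the agents, one after the other. -/
def roundStep {n N : ℕ} (a : ℝ → ℝ) (κ : ℕ) (ε : ℝ) (x : St n N) : St n N :=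
  (List.finRange N).foldl (agentStep a κ ε) x

lemma norm_agentStep_le {n N κ : ℕ} {a : ℝ → ℝ} (ha0 : ∀ r, 0 ≤ a r) {M A ε : ℝ}
    (hA : ∀ r, 0 ≤ r → r ≤ 2 * M → |a r| ≤ A) (hε : 0 ≤ ε) (hεA : ε * (N * A) ≤ 1)
    {x : St n N} (hx : ‖x‖ ≤ M) (i : Fin N) : ‖agentStep a κ ε x i‖ ≤ M := by
  classical
  have hM : 0 ≤ M := (norm_nonneg x).trans hx
  have hxl : ∀ l, ‖x l‖ ≤ M := fun l => (norm_le_pi_norm x l).trans hx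
  rw [pi_norm_le_iff_of_nonneg hM]
  intro l
  rw [agentStep]
  rcases eq_or_ne l i with rfl | hl
  · rw [Function.update_self]
    set S := topoNbrs κ x l
    set w : Fin N → ℝ := fun j => a ‖x j - x l‖ with hw
    have hw0 : ∀ j, 0 ≤ w j := fun j => ha0 _
    have hwA : ∑ j ∈ S, w j ≤ N * A := by
      have h0 : ∀ j, w j ≤ A := fun j =>
        (le_abs_self _).trans (hA _ (norm_nonneg _) (norm_apply_sub_le hx j l))
      have hA0 : 0 ≤ A := (hw0 l).trans (h0 l)
      calc ∑ j ∈ S, w j ≤ ∑ _j ∈ S, A := Finset.sum_le_sum fun j _ => h0 j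
        _ = S.card * A := by simp
        _ ≤ N * A := by
          gcongr
          simpa using S.card_le_univ
    have e : x l + ε • ft a κ x l = (1 - ε * ∑ j ∈ S, w j) • x l + ε • ∑ j ∈ S, w j • x j := by
      simp only [ft, smul_sub, Finset.sum_sub_distrib, ← Finset.sum_smul, sub_smul, one_smul,
        mul_smul]
      abel
    have h1 : 0 ≤ 1 - ε * ∑ j ∈ S, w j := by
      have := mul_le_mul_of_nonneg_left hwA hε
      linarith
    rw [e]
    calc ‖(1 - ε * ∑ j ∈ S, w j) • x l + ε • ∑ j ∈ S, w j • x j‖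
        ≤ (1 - ε * ∑ j ∈ S, w j) * M + ε * ∑ j ∈ S, w j * M := by
          refine (norm_add_le _ _).trans ?_
          rw [norm_smul, norm_smul, Real.norm_of_nonneg h1, Real.norm_of_nonneg hε]
          gcongr
          · exact hxl l
          · refine (norm_sum_le _ _).trans (Finset.sum_le_sum fun j _ => ?_)
            rw [norm_smul, Real.norm_of_nonneg (hw0 j)]
            exact mul_le_mul_of_nonneg_left (hxl j) (hw0 j)
      _ = M := by rw [← Finset.sum_mul]; ring
  · rw [Function.update_of_ne hl]
    exact hxl l

lemma norm_agentStep_sub_le {n N κ : ℕ} {a : ℝ → ℝ} {M L ε : ℝ} (hε : 0 ≤ ε)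
    (hL0 : 0 ≤ L) (hL : ∀ σ, ∀ y : St n N, ‖y‖ ≤ M → ‖frozen a σ y‖ ≤ L)
    {x : St n N} (hx : ‖x‖ ≤ M) (i : Fin N) : ‖agentStep a κ ε x i - x‖ ≤ ε * L := by
  classical
  rw [pi_norm_le_iff_of_nonneg (by positivity)]
  intro l
  rw [Pi.sub_apply, agentStep]
  rcases eq_or_ne l i with rfl | hl
  · rw [Function.update_self, add_sub_cancel_left, norm_smul, Real.norm_of_nonneg hε]
    gcongr
    exact (norm_le_pi_norm (ft a κ x) l).trans (hL _ x hx)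
  · rw [Function.update_of_ne hl, sub_self, norm_zero]
    positivity

lemma foldl_agentStep {n N κ : ℕ} {a : ℝ → ℝ} (ha0 : ∀ r, 0 ≤ a r) {M A L ε : ℝ}
    (hA : ∀ r, 0 ≤ r → r ≤ 2 * M → |a r| ≤ A) (hε : 0 ≤ ε) (hεA : ε * (N * A) ≤ 1)
    (hL0 : 0 ≤ L) (hL : ∀ σ, ∀ y : St n N, ‖y‖ ≤ M → ‖frozen a σ y‖ ≤ L) :
    ∀ (l : List (Fin N)), l.Nodup → ∀ x : St n N, ‖x‖ ≤ M →
      ‖l.foldl (agentStep a κ ε) x‖ ≤ M ∧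
      (∀ i ∉ l, l.foldl (agentStep a κ ε) x i = x i) ∧
      ∀ i ∈ l, ∃ w, ‖w‖ ≤ M ∧ ‖w - x‖ ≤ l.length * (ε * L) ∧
        l.foldl (agentStep a κ ε) x i = x i + ε • ft a κ w i := by
  classical
  intro l
  induction l with
  | nil => intro _ x hx; simp [hx]
  | cons i l ih =>
    intro hnd x hx
    obtain ⟨hil, hnd'⟩ := List.nodup_cons.1 hnd
    have hx' := norm_agentStep_le (κ := κ) ha0 hA hε hεA hx i
    obtain ⟨h1, h2, h3⟩ := ih hnd' (agentStep a κ ε x i) hx'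
    rw [List.foldl_cons]
    refine ⟨h1, fun j hj => ?_, fun j hj => ?_⟩
    · rw [List.mem_cons, not_or] at hj
      rw [h2 j hj.2, agentStep, Function.update_of_ne hj.1]
    · by_cases hji : j = i
      · subst hji
        refine ⟨x, hx, ?_, ?_⟩
        · rw [sub_self, norm_zero]; positivity
        · rw [h2 j hil, agentStep, Function.update_self]
      · obtain ⟨w, hw, hwx, hw'⟩ := h3 j ((List.mem_cons.1 hj).resolve_left hji)
        refine ⟨w, hw, ?_, ?_⟩
        · have := norm_agentStep_sub_le (κ := κ) hε hL0 hL hx i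
          have h4 := norm_sub_le_norm_sub_add_norm_sub w (agentStep a κ ε x i) x
          rw [List.length_cons]
          push_cast
          linarith
        · rw [hw', agentStep, Function.update_of_ne hji]

lemma roundStep_spec {n N κ : ℕ} {a : ℝ → ℝ} (ha0 : ∀ r, 0 ≤ a r) {M A L ε : ℝ}
    (hA : ∀ r, 0 ≤ r → r ≤ 2 * M → |a r| ≤ A) (hε : 0 ≤ ε) (hεA : ε * (N * A) ≤ 1)
    (hL0 : 0 ≤ L) (hL : ∀ σ, ∀ y : St n N, ‖y‖ ≤ M → ‖frozen a σ y‖ ≤ L)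
    {x : St n N} (hx : ‖x‖ ≤ M) :
    ‖roundStep a κ ε x‖ ≤ M ∧ ‖roundStep a κ ε x - x‖ ≤ ε * L ∧
      ∃ w : Fin N → St n N, (∀ i, ‖w i - x‖ ≤ N * (ε * L)) ∧
        roundStep a κ ε x - x = ε • fun i => ft a κ (w i) i := by
  obtain ⟨h1, -, h3⟩ := foldl_agentStep (κ := κ) ha0 hA hε hεA hL0 hL (List.finRange N)
    (List.nodup_finRange N) x hx
  choose w hw hwx hw' using fun i => h3 i (List.mem_finRange i)
  have e : roundStep a κ ε x - x = ε • fun i => ft a κ (w i) i := by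
    ext1 i
    rw [Pi.sub_apply, roundStep, hw' i, add_sub_cancel_left, Pi.smul_apply]
  refine ⟨h1, ?_, w, fun i => by simpa using hwx i, e⟩
  rw [e, norm_smul, Real.norm_of_nonneg hε]
  gcongr
  rw [pi_norm_le_iff_of_nonneg hL0]
  exact fun i => (norm_le_pi_norm (ft a κ (w i)) i).trans (hL _ _ (hw i))

lemma measurable_agentStep {n N : ℕ} {a : ℝ → ℝ} (ha : Continuous a) (κ : ℕ) (ε : ℝ) (i : Fin N) :
    Measurable fun x : St n N => agentStep a κ ε x i := by
  have h1 : Measurable fun x : St n N => x i + ε • ft a κ x i :=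
    (measurable_pi_apply i).add (((measurable_pi_apply i).comp (measurable_ft ha κ)).const_smul ε)
  exact measurable_update'.comp (measurable_id.prodMk h1)

lemma measurable_foldl_agentStep {n N : ℕ} {a : ℝ → ℝ} (ha : Continuous a) (κ : ℕ) (ε : ℝ)
    (l : List (Fin N)) : Measurable fun x : St n N => l.foldl (agentStep a κ ε) x := by
  induction l with
  | nil => exact measurable_id
  | cons i l ih => exact ih.comp (measurable_agentStep ha κ ε i)

lemma le_exp_mul_of_inner_ge {V : Type*} [NormedAddCommGroup V] [InnerProductSpace ℝ V]
    {C ε : ℝ} (hε : 0 ≤ ε) (hC : ε * C ≤ 1 / 2) (hC0 : 0 ≤ C) {z z' v v' : V}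
    (h : -C * ‖z - z'‖ ^ 2 ≤ inner ℝ (v - v') (z - z')) :
    ‖z - z'‖ ≤ Real.exp (2 * (ε * C)) * ‖z + ε • v - (z' + ε • v')‖ := by
  rcases eq_or_ne z z' with rfl | hne
  · rw [sub_self, norm_zero]; positivity
  have hpos : 0 < ‖z - z'‖ := norm_pos_iff.2 (sub_ne_zero.2 hne)
  have e : z + ε • v - (z' + ε • v') = (z - z') + ε • (v - v') := by
    rw [smul_sub]; abel
  rw [e]
  set w := (z - z') + ε • (v - v')
  have h1 : (1 - ε * C) * ‖z - z'‖ ^ 2 ≤ inner ℝ w (z - z') := by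
    rw [inner_add_left, inner_smul_left, real_inner_self_eq_norm_sq]
    have := mul_le_mul_of_nonneg_left h hε
    simp only [conj_trivial]
    linarith
  have h2 : (1 - ε * C) * ‖z - z'‖ ≤ ‖w‖ := by
    have := h1.trans (real_inner_le_norm _ _)
    refine le_of_mul_le_mul_right ?_ hpos
    linarith
  have h3 : 1 ≤ Real.exp (2 * (ε * C)) * (1 - ε * C) := by
    have := Real.add_one_le_exp (2 * (ε * C))
    have h0 : 0 ≤ ε * C := by positivity
    nlinarith
  calc ‖z - z'‖ ≤ (Real.exp (2 * (ε * C)) * (1 - ε * C)) * ‖z - z'‖ :=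
        le_mul_of_one_le_left hpos.le h3
    _ = Real.exp (2 * (ε * C)) * ((1 - ε * C) * ‖z - z'‖) := by ring
    _ ≤ _ := by gcongr

section Volume

variable {n N κ : ℕ} {a : ℝ → ℝ} {M A C ε : ℝ}

lemma volume_le_agentStep (hε : 0 ≤ ε)
    (hC0 : 0 ≤ C) (hεC : ε * C ≤ 1 / 2)
    (hC : ∀ (x : St n N) (i : Fin N) (P Q : EuclideanSpace ℝ (Fin n)),
      ‖Function.update x i P‖ ≤ M → ‖Function.update x i Q‖ ≤ M →
      -C * ‖Q - P‖ ^ 2 ≤ inner ℝ (ft a κ (Function.update x i Q) i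
        - ft a κ (Function.update x i P) i) (Q - P)) (i : Fin N) {S W : Set (St n N)}
    (hS : MeasurableSet S) (hW : MeasurableSet W) (hSM : ∀ x ∈ S, ‖x‖ ≤ M)
    (hSW : ∀ x ∈ S, agentStep a κ ε x i ∈ W) :
    volume S ≤ ENNReal.ofReal (Real.exp (2 * (ε * C))) ^ n * volume W := by
  have := volume_le_of_update_expanding (D := (Real.exp (2 * (ε * C))).toNNReal) i hS hW
    (fun x => x i + ε • ft a κ x i) hSW ?_
  · simpa [ENNReal.ofReal] using this
  · intro x z z' hz hz'
    have h := le_exp_mul_of_inner_ge hε hεC hC0 (hC x i z' z (hSM _ hz') (hSM _ hz))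
    simp only [Function.update_self]
    rw [edist_dist, edist_dist, dist_eq_norm, dist_eq_norm]
    change _ ≤ ENNReal.ofReal _ * _
    rw [← ENNReal.ofReal_mul (by positivity)]
    exact ENNReal.ofReal_le_ofReal h

lemma volume_le_foldl_agentStep (ha : Continuous a) (ha0 : ∀ r, 0 ≤ a r)
    (hA : ∀ r, 0 ≤ r → r ≤ 2 * M → |a r| ≤ A) (hε : 0 ≤ ε) (hεA : ε * (N * A) ≤ 1)
    (hC0 : 0 ≤ C) (hεC : ε * C ≤ 1 / 2)
    (hC : ∀ (x : St n N) (i : Fin N) (P Q : EuclideanSpace ℝ (Fin n)),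
      ‖Function.update x i P‖ ≤ M → ‖Function.update x i Q‖ ≤ M →
      -C * ‖Q - P‖ ^ 2 ≤ inner ℝ (ft a κ (Function.update x i Q) i
        - ft a κ (Function.update x i P) i) (Q - P)) (l : List (Fin N)) :
    ∀ {S W : Set (St n N)}, MeasurableSet S → MeasurableSet W → (∀ x ∈ S, ‖x‖ ≤ M) →
    (∀ x ∈ S, l.foldl (agentStep a κ ε) x ∈ W) →
    volume S ≤ (ENNReal.ofReal (Real.exp (2 * (ε * C))) ^ n) ^ l.length * volume W := by
  induction l with
  | nil =>
    intro S W _ _ _ hSW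
    simpa using measure_mono hSW
  | cons i l ih =>
    intro S W hS hW hSM hSW
    set S' : Set (St n N) := {x | ‖x‖ ≤ M} ∩ {x | l.foldl (agentStep a κ ε) x ∈ W}
    have hS' : MeasurableSet S' := (measurableSet_le measurable_norm measurable_const).inter
      (measurable_foldl_agentStep ha κ ε l hW)
    have h1 := ih hS' hW (fun x hx => hx.1) (fun x hx => hx.2)
    have h2 := volume_le_agentStep hε hC0 hεC hC i hS hS' hSM
      fun x hx => ⟨norm_agentStep_le ha0 hA hε hεA (hSM x hx) i, hSW x hx⟩
    rw [List.length_cons, pow_succ', mul_assoc]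
    exact h2.trans (by gcongr)

lemma volume_le_roundStep_iterate (ha : Continuous a) (ha0 : ∀ r, 0 ≤ a r)
    (hA : ∀ r, 0 ≤ r → r ≤ 2 * M → |a r| ≤ A) (hε : 0 ≤ ε) (hεA : ε * (N * A) ≤ 1)
    (hC0 : 0 ≤ C) (hεC : ε * C ≤ 1 / 2)
    (hC : ∀ (x : St n N) (i : Fin N) (P Q : EuclideanSpace ℝ (Fin n)),
      ‖Function.update x i P‖ ≤ M → ‖Function.update x i Q‖ ≤ M →
      -C * ‖Q - P‖ ^ 2 ≤ inner ℝ (ft a κ (Function.update x i Q) i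
        - ft a κ (Function.update x i P) i) (Q - P)) (m : ℕ)
    {S W : Set (St n N)} (hW : MeasurableSet W) (hSM : ∀ x ∈ S, ‖x‖ ≤ M)
    (hSW : ∀ x ∈ S, (roundStep a κ ε)^[m] x ∈ W) :
    volume S ≤ ENNReal.ofReal (Real.exp (2 * (ε * C) * (n * N * m))) * volume W := by
  have hmeas : Measurable (roundStep a κ ε : St n N → St n N) :=
    measurable_foldl_agentStep ha κ ε _
  have hball : ∀ x : St n N, ‖x‖ ≤ M → ‖roundStep a κ ε x‖ ≤ M := fun x hx => by
    obtain ⟨L, hL0, hL⟩ := exists_frozen_bound (n := n) (N := N) ha M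
    exact (roundStep_spec ha0 hA hε hεA hL0 hL hx).1
  have key : ∀ m : ℕ, volume ({x : St n N | ‖x‖ ≤ M} ∩ (roundStep a κ ε)^[m] ⁻¹' W) ≤
      ((ENNReal.ofReal (Real.exp (2 * (ε * C))) ^ n) ^ N) ^ m * volume W := by
    intro m
    induction m with
    | zero => simpa using measure_mono inter_subset_right
    | succ m ih =>
      have hm : ∀ m, MeasurableSet ({x : St n N | ‖x‖ ≤ M} ∩ (roundStep a κ ε)^[m] ⁻¹' W) :=
        fun m => (measurableSet_le measurable_norm measurable_const).inter (hmeas.iterate m hW)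
      have h1 := volume_le_foldl_agentStep ha ha0 hA hε hεA hC0 hεC hC (List.finRange N) (hm (m + 1))
        (hm m) (fun x hx => hx.1) (fun x hx => ⟨hball x hx.1, hx.2⟩)
      rw [List.length_finRange] at h1
      rw [pow_succ', mul_assoc]
      exact h1.trans (by gcongr)
  have e : ((ENNReal.ofReal (Real.exp (2 * (ε * C))) ^ n) ^ N) ^ m =
      ENNReal.ofReal (Real.exp (2 * (ε * C) * (n * N * m))) := by
    rw [← pow_mul, ← pow_mul, ← ENNReal.ofReal_pow (by positivity), ← Real.exp_nat_mul]
    push_cast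
    ring_nf
  rw [← e]
  have hsub : S ⊆ {x : St n N | ‖x‖ ≤ M} ∩ (roundStep a κ ε)^[m] ⁻¹' W :=
    fun x hx => ⟨hSM x hx, hSW x hx⟩
  exact (measure_mono hsub).trans (key m)

end Volume

/-! ### Convergence of the scheme -/

/-- Standing assumptions on the interaction kernel, with a speed bound `L` valid slightly
beyond the ball of radius `M`. -/
structure Admissible (n N κ : ℕ) (a : ℝ → ℝ) (M L : ℝ) : Prop where
  le_pred : κ ≤ N - 1
  lipschitz : ∃ K : ℝ≥0, LipschitzWith K a
  nonneg : ∀ r, 0 ≤ a r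
  radius_nonneg : 0 ≤ M
  speed_nonneg : 0 ≤ L
  speed : ∀ σ, ∀ y : St n N, ‖y‖ ≤ M + 1 → ‖frozen a σ y‖ ≤ L

lemma Admissible.continuous {n N κ : ℕ} {a : ℝ → ℝ} {M L : ℝ} (h : Admissible n N κ a M L) :
    Continuous a := by
  obtain ⟨K, hK⟩ := h.lipschitz
  exact hK.continuous

lemma Admissible.speed' {n N κ : ℕ} {a : ℝ → ℝ} {M L : ℝ} (h : Admissible n N κ a M L) :
    ∀ σ, ∀ y : St n N, ‖y‖ ≤ M → ‖frozen a σ y‖ ≤ L :=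
  fun σ y hy => h.speed σ y (by linarith)

lemma tendsto_floor_mul_step {t s : ℝ} (ht : 0 < t) (hs : 0 ≤ s) :
    Tendsto (fun m : ℕ => (⌊s / t * m⌋₊ : ℝ) * (t / m)) atTop (𝓝 s) := by
  have h := (tendsto_nat_floor_mul_div_atTop (R := ℝ) (a := s / t) (by positivity)).comp
    tendsto_natCast_atTop_atTop
  have h2 := h.mul_const t
  rw [div_mul_cancel₀ _ ht.ne'] at h2
  refine h2.congr fun m => ?_
  simp only [Function.comp]
  ring

lemma eventually_step_mul_le {t B c : ℝ} (hc : 0 < c) :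
    ∀ᶠ m : ℕ in atTop, t / m * B < c := by
  have h : Tendsto (fun m : ℕ => t / m * B) atTop (𝓝 (0 * B)) :=
    (tendsto_const_div_atTop_nhds_zero_nat t).mul_const B
  rw [zero_mul] at h
  exact h.eventually_lt_const hc

lemma exists_isSelSol_of_ultrafilter {n N κ : ℕ} {a : ℝ → ℝ} {M L : ℝ}
    (h : Admissible n N κ a M L) {p : St n N} (hp : ‖p‖ ≤ M) {t : ℝ} (ht : 0 < t)
    (U : Ultrafilter ℕ) (hU : (U : Filter ℕ) ≤ atTop) :
    ∃ x, IsSelSol a κ M L t x ∧ x 0 = p ∧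
      Tendsto (fun m : ℕ => (roundStep a κ (t / m))^[m] p) U (𝓝 (x t)) := by
  obtain ⟨A, hA0, hA⟩ := exists_kernel_bound h.continuous (2 * M)
  set z : ℕ → ℕ → St n N := fun m k => (roundStep a κ (t / m))^[k] p with hz_def
  have hz0 : ∀ m, z m 0 = p := fun m => rfl
  have hzs : ∀ m k, z m (k + 1) = roundStep a κ (t / m) (z m k) := fun m k =>
    Function.iterate_succ_apply' _ _ _
  have hz : ∀ᶠ m : ℕ in U, ∀ k, ‖z m k‖ ≤ M ∧ ‖z m (k + 1) - z m k‖ ≤ t / m * L ∧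
      ∃ w : Fin N → St n N, (∀ i, ‖w i - z m k‖ ≤ N * (t / m * L)) ∧
        z m (k + 1) - z m k = (t / m) • fun i => ft a κ (w i) i := by
    filter_upwards [hU (eventually_step_mul_le (t := t) (B := N * A) one_pos)] with m hm
    have hb : ∀ k, ‖z m k‖ ≤ M := by
      intro k
      induction k with
      | zero => exact hp
      | succ k ih =>
        rw [hzs]
        exact (roundStep_spec h.nonneg hA (by positivity) hm.le h.speed_nonneg h.speed' ih).1
    intro k
    rw [hzs]
    exact ⟨hb k,
      (roundStep_spec h.nonneg hA (by positivity) hm.le h.speed_nonneg h.speed' (hb k)).2⟩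
  have hzl : ∀ᶠ m : ℕ in U, ∀ k k' : ℕ, ‖z m k' - z m k‖ ≤ L * |k' * (t / m) - k * (t / m)| := by
    filter_upwards [hz] with m hm
    have h1 : ∀ k k' : ℕ, k ≤ k' → ‖z m k' - z m k‖ ≤ L * (k' * (t / m) - k * (t / m)) := by
      intro k k' hk
      induction k', hk using Nat.le_induction with
      | base => simp
      | succ k' hk ih =>
        have h2 := norm_sub_le_norm_sub_add_norm_sub (z m (k' + 1)) (z m k') (z m k)
        have h3 := (hm k').2.1
        push_cast
        linarith
    intro k k'
    rcases le_total k k' with hk | hk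
    · exact (h1 k k' hk).trans (mul_le_mul_of_nonneg_left (le_abs_self _) h.speed_nonneg)
    · rw [norm_sub_rev, abs_sub_comm]
      exact (h1 k' k hk).trans (mul_le_mul_of_nonneg_left (le_abs_self _) h.speed_nonneg)
  have hlim : ∀ s : ℝ, ∃ q, Tendsto (fun m : ℕ => z m ⌊s / t * m⌋₊) U (𝓝 q) := by
    intro s
    obtain ⟨q, -, hq⟩ := (isCompact_closedBall (0 : St n N) M).ultrafilter_le_nhds
      (U.map fun m : ℕ => z m ⌊s / t * m⌋₊) (by
        rw [le_principal_iff]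
        change ∀ᶠ m : ℕ in U, z m ⌊s / t * m⌋₊ ∈ Metric.closedBall 0 M
        filter_upwards [hz] with m hm
        simpa using (hm _).1)
    exact ⟨q, hq⟩
  choose x hx using hlim
  have hu : ∀ s, 0 ≤ s → Tendsto (fun m : ℕ => (⌊s / t * m⌋₊ : ℝ) * (t / m)) U (𝓝 s) :=
    fun s hs => (tendsto_floor_mul_step ht hs).mono_left hU
  refine ⟨x, ⟨fun s _ => ?_, fun s hs s' hs' => ?_, fun τ hτ Λ c hc => ?_⟩, ?_, ?_⟩
  · refine le_of_tendsto (hx s).norm ?_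
    filter_upwards [hz] with m hm
    exact (hm _).1
  · refine le_of_tendsto_of_tendsto ((hx s').sub (hx s)).norm
      (((hu s' hs'.1).sub (hu s hs.1)).abs.const_mul L) ?_
    filter_upwards [hzl] with m hm
    exact hm _ _
  · obtain ⟨ρ, hρ, H⟩ := eventually_apply_ft_lt h.le_pred h.continuous (x τ) Λ c hc
    have hL1 : 0 < 4 * (L + 1) := by linarith [h.speed_nonneg]
    refine ⟨ρ / (4 * (L + 1)), by positivity, fun s hs s' hs' h1 h2 hss' => ?_⟩
    set δ := ρ / (4 * (L + 1)) with hδ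
    have hLδ : L * δ ≤ ρ / 4 := by
      rw [hδ, mul_div_assoc', div_le_div_iff₀ hL1 (by norm_num)]
      nlinarith
    refine le_of_tendsto_of_tendsto
      (((Λ.continuous.tendsto _).comp (hx s')).sub ((Λ.continuous.tendsto _).comp (hx s)))
      (((hu s' hs'.1).sub (hu s hs.1)).const_mul c) ?_
    filter_upwards [hz, hzl, (hx τ).eventually (Metric.ball_mem_nhds _ (by positivity : 0 < ρ / 4)),
      hU (eventually_step_mul_le (t := t) (B := N * L) (by positivity : 0 < ρ / 4)),
      ((hu s hs.1).sub (hu τ hτ.1)).abs.eventually_lt_const h1,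
      ((hu s' hs'.1).sub (hu τ hτ.1)).abs.eventually_lt_const h2] with m hm hml hmτ hmN hms hms'
    have hidx : ⌊s / t * m⌋₊ ≤ ⌊s' / t * m⌋₊ := Nat.floor_mono (by gcongr)
    have hε : 0 ≤ t / m := by positivity
    have key : ∀ k, ⌊s / t * m⌋₊ ≤ k → k ≤ ⌊s' / t * m⌋₊ →
        Λ (z m k) - Λ (z m ⌊s / t * m⌋₊) ≤ c * (k * (t / m) - ⌊s / t * m⌋₊ * (t / m)) := by
      intro k hk
      induction k, hk using Nat.le_induction with
      | base => simp
      | succ k hk ih =>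
        intro hk'
        have ih' := ih (by omega)
        obtain ⟨-, -, w, hw, hw'⟩ := hm k
        have hk1 : (⌊s / t * m⌋₊ : ℝ) * (t / m) ≤ k * (t / m) := by gcongr
        have hk2 : (k : ℝ) * (t / m) ≤ ⌊s' / t * m⌋₊ * (t / m) := by
          gcongr; omega
        have hkτ : |k * (t / m) - ⌊τ / t * m⌋₊ * (t / m)| ≤ δ := by
          rw [abs_lt] at hms hms'
          rw [abs_le]
          constructor <;> linarith [hms.1, hms'.2]
        have hzk := hml ⌊τ / t * m⌋₊ k
        have hzk2 := mul_le_mul_of_nonneg_left hkτ h.speed_nonneg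
        have hwi : Λ (fun i => ft a κ (w i) i) < c := by
          refine H w fun i => ?_
          have h3 := norm_sub_le_norm_sub_add_norm_sub (w i) (z m k) (x τ)
          have h4 := norm_sub_le_norm_sub_add_norm_sub (z m k) (z m ⌊τ / t * m⌋₊) (x τ)
          have h5 : ‖z m ⌊τ / t * m⌋₊ - x τ‖ < ρ / 4 := by
            rw [← dist_eq_norm]; exact hmτ
          have h6 := hw i
          have h7 : (N : ℝ) * (t / m * L) = t / m * (N * L) := by ring
          linarith
        have h8 : Λ (z m (k + 1)) - Λ (z m k) ≤ t / m * c := by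
          rw [← map_sub, hw', map_smul, smul_eq_mul]
          gcongr
        push_cast
        linarith
    exact key _ hidx le_rfl
  · refine tendsto_nhds_unique (hx 0) ?_
    simp [hz0]
  · refine (hx t).congr fun m => ?_
    rw [div_self ht.ne', one_mul, Nat.floor_natCast]

/-! ### Volume estimate under uniqueness -/

/-- Uniqueness of the generalized solution from `p` up to time `t`. -/
def UniqueUpTo {n N : ℕ} (a : ℝ → ℝ) (κ : ℕ) (M L : ℝ) (p : St n N) (t : ℝ) : Prop :=
  ∀ s ≤ t, ∀ x y, IsSelSol a κ M L s x → IsSelSol a κ M L s y → x 0 = p → y 0 = p →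
    ∀ r ∈ Icc 0 s, x r = y r

lemma exists_volume_le_of_flow {n N κ : ℕ} {a : ℝ → ℝ} {M L : ℝ}
    (h : Admissible n N κ a M L) :
    ∃ C : ℝ, 0 ≤ C ∧ ∀ t, 0 ≤ t → ∀ S V : Set (St n N), IsOpen V →
      (∀ p ∈ S, ∃ x, IsSelSol a κ M L t x ∧ x 0 = p ∧ x t ∈ V ∧ UniqueUpTo a κ M L p t) →
      volume S ≤ ENNReal.ofReal (Real.exp (C * t)) * volume V := by
  obtain ⟨A, hA0, hA⟩ := exists_kernel_bound h.continuous (2 * M)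
  obtain ⟨K, hK⟩ := h.lipschitz
  obtain ⟨C, hC0, hC⟩ := exists_inner_ft_update_ge (n := n) h.le_pred hK h.nonneg M h.radius_nonneg
  refine ⟨2 * C * n * N, by positivity, fun t ht S V hV hS => ?_⟩
  rcases ht.eq_or_lt with rfl | ht
  · have hSV : S ⊆ V := by
      intro p hp
      obtain ⟨x, -, hx0, hxV, -⟩ := hS p hp
      rwa [hx0] at hxV
    simpa using measure_mono hSV
  have hSM : ∀ p ∈ S, ‖p‖ ≤ M := by
    intro p hp
    obtain ⟨x, hx, rfl, -⟩ := hS p hp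
    exact hx.bound 0 ⟨le_rfl, ht.le⟩
  obtain ⟨m₀, hm₀⟩ := eventually_atTop.1 ((eventually_step_mul_le (t := t) (B := N * A) one_pos).and
    ((eventually_step_mul_le (t := t) (B := C) (by norm_num : (0 : ℝ) < 1 / 2)).and
      (eventually_gt_atTop 0)))
  set B : ℕ → Set (St n N) := fun k => S ∩ {p | ∀ m ≥ k, (roundStep a κ (t / m))^[m] p ∈ V}
  have hB : ∀ k, volume (B k) ≤ ENNReal.ofReal (Real.exp (2 * C * n * N * t)) * volume V := by
    intro k
    obtain ⟨h1, h2, h3⟩ := hm₀ (max k m₀) (le_max_right _ _)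
    have := volume_le_roundStep_iterate h.continuous h.nonneg hA
      (by positivity) h1.le hC0 h2.le hC (max k m₀) (S := B k) hV.measurableSet
      (fun p hp => hSM p hp.1) (fun p hp => hp.2 _ (le_max_left _ _))
    refine this.trans_eq ?_
    have h4 : ((max k m₀ : ℕ) : ℝ) ≠ 0 := by exact_mod_cast h3.ne'
    congr 3
    field_simp
  have hSB : S ⊆ ⋃ k, B k := by
    intro p hp
    rw [mem_iUnion]
    by_contra! hcon
    have hfreq : ∃ᶠ m : ℕ in atTop, (roundStep a κ (t / m))^[m] p ∉ V := by
      rw [frequently_atTop]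
      intro k
      have := hcon k
      simp only [B, mem_inter_iff, mem_ofPred_eq, hp, true_and, not_forall] at this
      obtain ⟨m, hm, hm'⟩ := this
      exact ⟨m, hm, hm'⟩
    have : NeBot (atTop ⊓ 𝓟 {m : ℕ | (roundStep a κ (t / m))^[m] p ∉ V}) :=
      frequently_mem_iff_neBot.1 hfreq
    set U := Ultrafilter.of (atTop ⊓ 𝓟 {m : ℕ | (roundStep a κ (t / m))^[m] p ∉ V})
    have hU := Ultrafilter.of_le (atTop ⊓ 𝓟 {m : ℕ | (roundStep a κ (t / m))^[m] p ∉ V})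
    obtain ⟨y, hy, hy0, hyt⟩ := exists_isSelSol_of_ultrafilter h (hSM p hp) ht U
      (hU.trans inf_le_left)
    obtain ⟨x, hx, hx0, hxV, hun⟩ := hS p hp
    have hxy := hun t le_rfl x y hx hy hx0 hy0 t ⟨ht.le, le_rfl⟩
    rw [← hxy] at hyt
    have h1 := hyt.eventually (hV.mem_nhds hxV)
    have h2 : ∀ᶠ m : ℕ in U, (roundStep a κ (t / m))^[m] p ∉ V :=
      hU (mem_inf_of_right (mem_principal_self _))
    obtain ⟨m, hm1, hm2⟩ := (h1.and h2).exists
    exact hm2 hm1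
  refine (measure_mono hSB).trans ?_
  have hmono : Monotone B := by
    intro k k' hk p hp
    exact ⟨hp.1, fun m hm => hp.2 m (hk.trans hm)⟩
  rw [hmono.measure_iUnion]
  exact iSup_le hB

lemma UniqueUpTo.mono {n N κ : ℕ} {a : ℝ → ℝ} {M L s t : ℝ} {p : St n N}
    (h : UniqueUpTo a κ M L p t) (hs : s ≤ t) : UniqueUpTo a κ M L p s :=
  fun r hr => h r (hr.trans hs)

/-- Initial data reaching small sets shortly before the end of their uniqueness interval form a
null set. -/
lemma volume_eq_zero_of_terminal {n N κ : ℕ} {a : ℝ → ℝ} {M L : ℝ}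
    (h : Admissible n N κ a M L) {S : Set (St n N)} {T B ε₀ : ℝ} (hT : 0 ≤ T)
    (hε₀ : 0 < ε₀) (V : ℝ → Set (St n N)) (hVo : ∀ ε, 0 < ε → ε < ε₀ → IsOpen (V ε))
    (hV : ∀ ε, 0 < ε → ε < ε₀ → volume (V ε) ≤ ENNReal.ofReal (B * ε ^ 2))
    (hS : ∀ p ∈ S, ∃ τ ∈ Icc 0 T, ∃ x, IsSelSol a κ M L τ x ∧ x 0 = p ∧ UniqueUpTo a κ M L p τ ∧
      ∀ ε, 0 < ε → ε < ε₀ → ∀ t ∈ Icc 0 τ, τ - t < ε → x t ∈ V ε) :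
    volume S = 0 := by
  obtain ⟨C, hC0, hC⟩ := exists_volume_le_of_flow h
  have key : ∀ ε, 0 < ε → ε < ε₀ →
      volume S ≤ ENNReal.ofReal ((T / ε + 1) * (Real.exp (C * T) * (|B| * ε ^ 2))) := by
    intro ε hε hεε₀
    set F : ℕ → Set (St n N) := fun k => {p | ∃ x, IsSelSol a κ M L (k * ε) x ∧ x 0 = p ∧
      x (k * ε) ∈ V ε ∧ UniqueUpTo a κ M L p (k * ε)} with hF
    set m := ⌊T / ε⌋₊
    have hcov : S ⊆ ⋃ k ∈ Finset.range (m + 1), F k := by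
      intro p hp
      obtain ⟨τ, hτ, x, hx, hx0, hun, hxV⟩ := hS p hp
      have h0 : (⌊τ / ε⌋₊ : ℝ) * ε ≤ τ := by
        rw [← le_div_iff₀ hε]; exact Nat.floor_le (div_nonneg hτ.1 hε.le)
      have h1 : τ - ⌊τ / ε⌋₊ * ε < ε := by
        have := Nat.lt_floor_add_one (τ / ε)
        rw [div_lt_iff₀ hε] at this
        linarith
      simp only [mem_iUnion]
      refine ⟨⌊τ / ε⌋₊, ?_, x, hx.mono h0, hx0, hxV ε hε hεε₀ _ ⟨by positivity, h0⟩ h1,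
        hun.mono h0⟩
      rw [Finset.mem_range, Nat.lt_succ_iff]
      exact Nat.floor_mono (div_le_div_of_nonneg_right hτ.2 hε.le)
    have hk : ∀ k ∈ Finset.range (m + 1),
        volume (F k) ≤ ENNReal.ofReal (Real.exp (C * T) * (|B| * ε ^ 2)) := by
      intro k hk
      have h1 := hC (k * ε) (by positivity) (F k) (V ε) (hVo ε hε hεε₀) fun p hp => hp
      have hkT : (k : ℝ) * ε ≤ T := by
        rw [← le_div_iff₀ hε]
        have : k ≤ m := Nat.lt_succ_iff.1 (Finset.mem_range.1 hk)
        exact (Nat.cast_le.2 this).trans (Nat.floor_le (by positivity))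
      refine h1.trans ?_
      rw [ENNReal.ofReal_mul (by positivity)]
      gcongr
      exact (hV ε hε hεε₀).trans (ENNReal.ofReal_le_ofReal (by gcongr; exact le_abs_self B))
    calc volume S ≤ volume (⋃ k ∈ Finset.range (m + 1), F k) := measure_mono hcov
      _ ≤ ∑ k ∈ Finset.range (m + 1), volume (F k) := measure_biUnion_finset_le _ _
      _ ≤ ∑ _k ∈ Finset.range (m + 1), ENNReal.ofReal (Real.exp (C * T) * (|B| * ε ^ 2)) :=
        Finset.sum_le_sum hk
      _ = ENNReal.ofReal ((m + 1 : ℕ) * (Real.exp (C * T) * (|B| * ε ^ 2))) := by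
        rw [Finset.sum_const, Finset.card_range, nsmul_eq_mul,
          ENNReal.ofReal_mul (Nat.cast_nonneg (m + 1)), ENNReal.ofReal_natCast]
      _ ≤ _ := by
        refine ENNReal.ofReal_le_ofReal ?_
        gcongr
        push_cast
        gcongr
        exact Nat.floor_le (by positivity)
  have hlim : Tendsto (fun ε : ℝ => ENNReal.ofReal
      (Real.exp (C * T) * |B| * (T * ε + ε ^ 2))) (𝓝[>] 0) (𝓝 0) := by
    have h1 : Continuous fun ε : ℝ => ENNReal.ofReal
        (Real.exp (C * T) * |B| * (T * ε + ε ^ 2)) := by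
      refine ENNReal.continuous_ofReal.comp ?_
      fun_prop
    have h2 := (h1.tendsto 0).mono_left (nhdsWithin_le_nhds (s := Ioi 0))
    simpa using h2
  refine le_antisymm (ge_of_tendsto hlim ?_) zero_le
  filter_upwards [Ioo_mem_nhdsGT hε₀] with ε hε
  refine (key ε hε.1 hε.2).trans_eq ?_
  congr 1
  have := hε.1.ne'
  field_simp

/-- Local uniqueness of generalized solutions from `p`. -/
def LocallyUnique {n N : ℕ} (a : ℝ → ℝ) (κ : ℕ) (M L : ℝ) (p : St n N) : Prop :=
  ∃ δ > 0, UniqueUpTo a κ M L p δ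

lemma exists_terminal_of_not_unique {n N κ : ℕ} {a : ℝ → ℝ} {M L T : ℝ} {p : St n N}
    {x₀ y₀ : ℝ → St n N} (hx₀ : IsSelSol a κ M L T x₀) (hy₀ : IsSelSol a κ M L T y₀)
    (hx₀p : x₀ 0 = p) (hy₀p : y₀ 0 = p) (hne : ∃ t ∈ Icc 0 T, x₀ t ≠ y₀ t) :
    ∃ τ ∈ Icc 0 T, ∃ x, IsSelSol a κ M L τ x ∧ x 0 = p ∧ UniqueUpTo a κ M L p τ ∧
      ¬ LocallyUnique a κ M L (x τ) := by
  obtain ⟨r₀, hr₀, hne⟩ := hne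
  set I : Set ℝ := {s | UniqueUpTo a κ M L p s}
  have h0 : (0 : ℝ) ∈ I := by
    intro s hs x y _ _ hx hy r hr
    obtain rfl : r = 0 := le_antisymm (hr.2.trans hs) hr.1
    rw [hx, hy]
  have hbd : ∀ s ∈ I, s ≤ T := by
    intro s hs
    by_contra! hlt
    exact hne (hs T hlt.le _ _ hx₀ hy₀ hx₀p hy₀p r₀ hr₀)
  have hbdd : BddAbove I := ⟨T, hbd⟩
  set τ := sSup I
  have hτ0 : 0 ≤ τ := le_csSup hbdd h0
  have hτT : τ ≤ T := csSup_le ⟨0, h0⟩ hbd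
  have hlt : ∀ s x y, IsSelSol a κ M L s x → IsSelSol a κ M L s y → x 0 = p → y 0 = p →
      ∀ r ∈ Icc 0 s, r < τ → x r = y r := by
    intro s x y hx hy hxp hyp r hr hrτ
    obtain ⟨s', hs', hrs'⟩ := exists_lt_of_lt_csSup ⟨0, h0⟩ hrτ
    exact hs' r hrs'.le x y (hx.mono hr.2) (hy.mono hr.2) hxp hyp r ⟨hr.1, le_rfl⟩
  have hun : UniqueUpTo a κ M L p τ := by
    intro s hs x y hx hy hxp hyp r hr
    rcases (hr.2.trans hs).lt_or_eq with hrτ | hrτ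
    · exact hlt s x y hx hy hxp hyp r hr hrτ
    rcases hr.1.eq_or_lt with h | hrpos
    · rw [← h, hxp, hyp]
    have hsub : Ico 0 r ⊆ Icc 0 s := fun u hu => ⟨hu.1, hu.2.le.trans hr.2⟩
    have hcl : r ∈ closure (Ico 0 r) := by
      rw [closure_Ico hrpos.ne]; exact ⟨hrpos.le, le_rfl⟩
    have := mem_closure_iff_nhdsWithin_neBot.1 hcl
    refine tendsto_nhds_unique_of_eventuallyEq
      ((hx.continuousOn r hr).mono_left (nhdsWithin_mono _ hsub))
      ((hy.continuousOn r hr).mono_left (nhdsWithin_mono _ hsub)) ?_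
    filter_upwards [self_mem_nhdsWithin] with u hu
    exact hlt s x y hx hy hxp hyp u (hsub hu) (hu.2.trans_eq hrτ)
  refine ⟨τ, ⟨hτ0, hτT⟩, x₀, hx₀.mono hτT, hx₀p, hun, ?_⟩
  rintro ⟨δ, hδ, hloc⟩
  have : τ + δ ∈ I := by
    intro s hs x y hx hy hxp hyp r hr
    rcases le_total r τ with hrτ | hrτ
    · exact hun r hrτ x y (hx.mono hr.2) (hy.mono hr.2) hxp hyp r ⟨hr.1, le_rfl⟩
    have hτs : τ ≤ s := hrτ.trans hr.2
    have hx1 := hun τ le_rfl x x₀ (hx.mono hτs) (hx₀.mono hτT) hxp hx₀p τ ⟨hτ0, le_rfl⟩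
    have hy1 := hun τ le_rfl y x₀ (hy.mono hτs) (hx₀.mono hτT) hyp hx₀p τ ⟨hτ0, le_rfl⟩
    have := hloc (s - τ) (by linarith) _ _ (hx.shift hτ0 (by linarith)) (hy.shift hτ0 (by linarith))
      (by simpa using hx1) (by simpa using hy1) (r - τ) ⟨by linarith, by linarith [hr.2]⟩
    simpa using this
  have := le_csSup hbdd this
  linarith

/-! ### Observables along generalized solutions -/

lemma IsSelSol.exists_forall_mul_le_sub {n N κ : ℕ} {a : ℝ → ℝ} {M L T t c : ℝ}
    {x : ℝ → St n N} (hx : IsSelSol a κ M L T x) (hL : 0 ≤ L) (ht : t ∈ Icc 0 T)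
    {q : St n N → ℝ} {q' : St n N →L[ℝ] ℝ} (hq : HasFDerivAt q q' (x t))
    (hc : ∀ σ, IsSel κ (x t) σ → c < q' (frozen a σ (x t))) :
    ∃ δ > 0, ∀ s ∈ Icc 0 T, t ≤ s → s < t + δ → c * (s - t) ≤ q (x s) - q (x t) := by
  obtain ⟨c', hcc', hc'⟩ : ∃ c', c < c' ∧ ∀ σ, IsSel κ (x t) σ → c' < q' (frozen a σ (x t)) := by
    have h : ∀ᶠ c' in 𝓝[>] c, ∀ σ, IsSel κ (x t) σ → c' < q' (frozen a σ (x t)) := by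
      refine eventually_all.2 fun σ => ?_
      by_cases hσ : IsSel κ (x t) σ
      · filter_upwards [mem_nhdsWithin_of_mem_nhds (Iio_mem_nhds (hc σ hσ))] with c' h _ using h
      · exact Eventually.of_forall fun _ h => absurd h hσ
    obtain ⟨c', h1, h2⟩ := (h.and self_mem_nhdsWithin).exists
    exact ⟨c', h2, h1⟩
  obtain ⟨δ₁, hδ₁, H₁⟩ := hx.incl t ht (-q') (-c') fun σ hσ => by simpa using hc' σ hσ
  have hη : 0 < (c' - c) / (L + 1) := div_pos (by linarith) (by linarith)
  have h2 : ∀ᶠ s in 𝓝[Icc 0 T] t, ‖q (x s) - q (x t) - q' (x s - x t)‖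
      ≤ (c' - c) / (L + 1) * ‖x s - x t‖ :=
    (hx.continuousOn t ht).eventually (hq.isLittleO.def hη)
  obtain ⟨δ₂, hδ₂, H₂⟩ := Metric.mem_nhdsWithin_iff.1 h2
  refine ⟨min δ₁ δ₂, lt_min hδ₁ hδ₂, fun s hs hts hsδ => ?_⟩
  have habs : |s - t| < min δ₁ δ₂ := by rw [abs_of_nonneg (by linarith)]; linarith
  have h3 := H₁ t ht s hs (by simpa using hδ₁) (habs.trans_le (min_le_left _ _)) hts
  have h4 := H₂ ⟨by rw [Metric.mem_ball, Real.dist_eq]; exact habs.trans_le (min_le_right _ _), hs⟩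
  have h5 := hx.lip t ht s hs
  rw [abs_of_nonneg (by linarith)] at h5
  have h6 : (c' - c) / (L + 1) * ‖x s - x t‖ ≤ (c' - c) * (s - t) := by
    calc (c' - c) / (L + 1) * ‖x s - x t‖ ≤ (c' - c) / (L + 1) * (L * (s - t)) := by gcongr
      _ ≤ (c' - c) / (L + 1) * ((L + 1) * (s - t)) := by gcongr; linarith
      _ = (c' - c) * (s - t) := by field_simp
  have h7 := (abs_le.1 (h4.trans h6)).1
  simp only [neg_apply] at h3
  rw [map_sub] at h7
  linarith

/-- A strict lower barrier for an observable along a generalized solution. -/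
lemma IsSelSol.barrier_le {n N κ : ℕ} {a : ℝ → ℝ} {M L T s₀ s₁ : ℝ}
    {x : ℝ → St n N} (hx : IsSelSol a κ M L T x) (hL : 0 ≤ L) (h0 : 0 ≤ s₀) (h1 : s₁ ≤ T)
    {q : St n N → ℝ} {q' : St n N → St n N →L[ℝ] ℝ} (hq : ∀ y, HasFDerivAt q (q' y) y)
    {B B' : ℝ → ℝ} (hB : ∀ r, HasDerivAt B (B' r) r) (hstart : B s₀ ≤ q (x s₀))
    (hc : ∀ r ∈ Ico s₀ s₁, q (x r) = B r → ∀ σ, IsSel κ (x r) σ →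
      B' r < q' (x r) (frozen a σ (x r))) :
    ∀ r ∈ Icc s₀ s₁, B r ≤ q (x r) := by
  have hqc : Continuous q := continuous_iff_continuousAt.2 fun y => (hq y).continuousAt
  have hsub : Icc s₀ s₁ ⊆ Icc 0 T := Icc_subset_Icc h0 h1
  have hqx : ContinuousOn (fun r => q (x r)) (Icc s₀ s₁) :=
    hqc.comp_continuousOn (hx.continuousOn.mono hsub)
  have hBc : Continuous B := continuous_iff_continuousAt.2 fun y => (hB y).continuousAt
  have key : Icc s₀ s₁ ⊆ {r | B r ≤ q (x r)} := by
    refine IsClosed.Icc_subset_of_forall_exists_gt ?_ hstart ?_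
    · have := isClosed_Icc.isClosed_le hBc.continuousOn hqx
      convert this using 1
      ext r
      exact and_comm
    · rintro r ⟨hr, hr'⟩ s hs
      have hrT : r ∈ Icc 0 T := hsub ⟨hr'.1, hr'.2.le⟩
      rcases (show B r ≤ q (x r) from hr).lt_or_eq with hlt | heq
      · have h2 : ∀ᶠ u in 𝓝[Icc s₀ s₁] r, B u < q (x u) :=
          (hBc.continuousWithinAt (s := Icc s₀ s₁)).eventually_lt (hqx r ⟨hr'.1, hr'.2.le⟩) hlt
        obtain ⟨δ, hδ, H⟩ := Metric.mem_nhdsWithin_iff.1 h2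
        obtain ⟨u, hu1, hu2⟩ := exists_between (lt_min hs (lt_min hr'.2 (by linarith : r < r + δ)))
        rw [lt_min_iff, lt_min_iff] at hu2
        refine ⟨u, ?_, hu1, hu2.1.le⟩
        have hd : u ∈ Metric.ball r δ := by
          rw [Metric.mem_ball, Real.dist_eq, abs_of_pos (by linarith)]; linarith [hu2.2.2]
        exact (show B u < q (x u) from H ⟨hd, hr'.1.trans hu1.le, hu2.2.1.le⟩).le
      · have hlt : ∀ᶠ c in 𝓝[>] (B' r), ∀ σ, IsSel κ (x r) σ →
            c < q' (x r) (frozen a σ (x r)) := by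
          refine eventually_all.2 fun σ => ?_
          by_cases hσ : IsSel κ (x r) σ
          · filter_upwards [mem_nhdsWithin_of_mem_nhds (Iio_mem_nhds (hc r hr' heq.symm σ hσ))]
              with c' h _ using h
          · exact Eventually.of_forall fun _ h => absurd h hσ
        obtain ⟨c, h2, h3⟩ := (hlt.and self_mem_nhdsWithin).exists
        obtain ⟨δ₁, hδ₁, H₁⟩ := hx.exists_forall_mul_le_sub hL hrT (hq _) h2
        have h4 : ∀ᶠ u in 𝓝 r, ‖B u - B r - (u - r) • B' r‖ ≤ (c - B' r) * ‖u - r‖ :=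
          (hasDerivAt_iff_isLittleO.1 (hB r)).def (sub_pos.2 h3)
        obtain ⟨δ₂, hδ₂, H₂⟩ := Metric.eventually_nhds_iff.1 h4
        obtain ⟨u, hu1, hu2⟩ := exists_between (lt_min hs (lt_min hr'.2
          (lt_min (by linarith : r < r + δ₁) (by linarith : r < r + δ₂))))
        rw [lt_min_iff, lt_min_iff, lt_min_iff] at hu2
        refine ⟨u, ?_, hu1, hu2.1.le⟩
        have h5 := H₁ u (hsub ⟨hr'.1.trans hu1.le, hu2.2.1.le⟩) hu1.le hu2.2.2.1
        have h6 := H₂ (y := u) (by rw [Real.dist_eq, abs_of_pos (by linarith)]; linarith [hu2.2.2.2])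
        rw [Real.norm_eq_abs, Real.norm_eq_abs, abs_of_pos (by linarith : 0 < u - r),
          smul_eq_mul] at h6
        have h7 := (abs_le.1 h6).2
        change B u ≤ q (x u)
        linarith
  exact key

lemma hasDerivWithinAt_of_forall_dual {E : Type*} [NormedAddCommGroup E] [NormedSpace ℝ E]
    [FiniteDimensional ℝ E] {x : ℝ → E} {v : E} {s : Set ℝ} {t : ℝ}
    (h : ∀ Λ : E →L[ℝ] ℝ, HasDerivWithinAt (fun r => Λ (x r)) (Λ v) s t) :
    HasDerivWithinAt x v s t := by
  let e : E ≃L[ℝ] (Fin (Module.finrank ℝ E) → ℝ) :=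
    ContinuousLinearEquiv.ofFinrankEq (by simp)
  have h1 : HasDerivWithinAt (fun r => e (x r)) (e v) s t := by
    rw [hasDerivWithinAt_pi]
    intro i
    exact h ((ContinuousLinearMap.proj (R := ℝ) (φ := fun _ : Fin (Module.finrank ℝ E) => ℝ) i).comp
      (e : E →L[ℝ] (Fin (Module.finrank ℝ E) → ℝ)))
  have h2 := (e.symm : _ →L[ℝ] E).hasFDerivAt.comp_hasDerivWithinAt t h1
  simpa [Function.comp_def] using h2

lemma IsSelSol.hasDerivWithinAt {n N κ : ℕ} {a : ℝ → ℝ} {M L T t : ℝ}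
    {x : ℝ → St n N} (hx : IsSelSol a κ M L T x) (ht : t ∈ Icc 0 T) {v : St n N}
    (hv : ∀ σ, IsSel κ (x t) σ → frozen a σ (x t) = v) :
    HasDerivWithinAt x v (Icc 0 T) t := by
  refine hasDerivWithinAt_of_forall_dual fun Λ => ?_
  rw [hasDerivWithinAt_iff_isLittleO, Asymptotics.isLittleO_iff]
  intro ε hε
  obtain ⟨δ₁, hδ₁, H₁⟩ := hx.incl t ht Λ (Λ v + ε) fun σ hσ => by rw [hv σ hσ]; linarith
  obtain ⟨δ₂, hδ₂, H₂⟩ := hx.incl t ht (-Λ) (-Λ v + ε) fun σ hσ => by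
    rw [hv σ hσ, neg_apply]; linarith
  refine Metric.mem_nhdsWithin_iff.2 ⟨min δ₁ δ₂, lt_min hδ₁ hδ₂, ?_⟩
  rintro s ⟨hs, hsT⟩
  rw [Metric.mem_ball, Real.dist_eq, lt_min_iff] at hs
  have h01 : |t - t| < δ₁ := by simpa using hδ₁
  have h02 : |t - t| < δ₂ := by simpa using hδ₂
  change ‖Λ (x s) - Λ (x t) - (s - t) • Λ v‖ ≤ ε * ‖s - t‖
  rw [Real.norm_eq_abs, Real.norm_eq_abs, smul_eq_mul, abs_le]
  rcases le_total t s with hts | hts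
  · have h1 := H₁ t ht s hsT h01 hs.1 hts
    have h2 := H₂ t ht s hsT h02 hs.2 hts
    simp only [neg_apply] at h2
    rw [abs_of_nonneg (by linarith)]
    constructor <;> linarith
  · have h1 := H₁ s hsT t ht hs.1 h01 hts
    have h2 := H₂ s hsT t ht hs.2 h02 hts
    simp only [neg_apply] at h2
    rw [abs_of_nonpos (by linarith)]
    constructor <;> linarith

lemma exists_frozen_lipschitzOnWith {n N : ℕ} {a : ℝ → ℝ} {K : ℝ≥0} (ha : LipschitzWith K a)
    (M : ℝ) : ∃ K' : ℝ≥0, ∀ σ, LipschitzOnWith K' (frozen a σ : St n N → St n N)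
      (Metric.closedBall 0 M) := by
  obtain ⟨A, hA0, hA⟩ := exists_kernel_bound ha.continuous (2 * M)
  have hK : 0 ≤ N * (2 * A + 4 * K * |M|) := by positivity
  refine ⟨NNReal.mk (N * (2 * A + 4 * K * |M|)) hK, fun σ => LipschitzOnWith.of_dist_le_mul
    fun x hx y hy => ?_⟩
  rw [mem_closedBall_zero_iff] at hx hy
  have hM := le_abs_self M
  rw [dist_eq_norm, dist_eq_norm, NNReal.coe_mk, pi_norm_le_iff_of_nonneg (by positivity)]
  intro i
  rw [Pi.sub_apply, frozen, frozen, ← Finset.sum_sub_distrib]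
  have hterm : ∀ j ∈ σ i, ‖a ‖x j - x i‖ • (x j - x i) - a ‖y j - y i‖ • (y j - y i)‖
      ≤ (2 * A + 4 * K * |M|) * ‖x - y‖ := by
    intro j _
    have h1 : ‖(x j - x i) - (y j - y i)‖ ≤ 2 * ‖x - y‖ := by
      have e : (x j - x i) - (y j - y i) = (x - y) j - (x - y) i := by
        simp only [Pi.sub_apply]; abel
      rw [e]
      linarith [norm_sub_le ((x - y) j) ((x - y) i), norm_le_pi_norm (x - y) j,
        norm_le_pi_norm (x - y) i]
    have h2 : |a ‖x j - x i‖ - a ‖y j - y i‖| ≤ K * (2 * ‖x - y‖) := by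
      have := ha.dist_le_mul ‖x j - x i‖ ‖y j - y i‖
      rw [Real.dist_eq, Real.dist_eq] at this
      refine this.trans (mul_le_mul_of_nonneg_left ?_ K.2)
      exact (abs_norm_sub_norm_le _ _).trans h1
    have e : a ‖x j - x i‖ • (x j - x i) - a ‖y j - y i‖ • (y j - y i) =
        a ‖x j - x i‖ • ((x j - x i) - (y j - y i))
          + (a ‖x j - x i‖ - a ‖y j - y i‖) • (y j - y i) := by
      rw [smul_sub _ (x j - x i) (y j - y i), sub_smul]; abel
    rw [e]
    have h3 := hA _ (norm_nonneg _) (norm_apply_sub_le hx j i)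
    have h4 : ‖y j - y i‖ ≤ 2 * |M| := (norm_apply_sub_le hy j i).trans (by linarith)
    calc _ ≤ |a ‖x j - x i‖| * ‖(x j - x i) - (y j - y i)‖
          + |a ‖x j - x i‖ - a ‖y j - y i‖| * ‖y j - y i‖ := by
          refine (norm_add_le _ _).trans_eq ?_
          rw [norm_smul, norm_smul, Real.norm_eq_abs, Real.norm_eq_abs]
      _ ≤ A * (2 * ‖x - y‖) + K * (2 * ‖x - y‖) * (2 * |M|) := by gcongr
      _ = _ := by ring
  calc _ ≤ ∑ j ∈ σ i, ‖a ‖x j - x i‖ • (x j - x i) - a ‖y j - y i‖ • (y j - y i)‖ :=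
        norm_sum_le _ _
    _ ≤ ∑ _j ∈ σ i, (2 * A + 4 * K * |M|) * ‖x - y‖ := Finset.sum_le_sum hterm
    _ = (σ i).card * ((2 * A + 4 * K * |M|) * ‖x - y‖) := by simp
    _ ≤ N * ((2 * A + 4 * K * |M|) * ‖x - y‖) := by
        gcongr
        simpa using (σ i).card_le_univ
    _ = _ := by ring

/-- Solutions which select a fixed neighbour structure at positive times are unique. -/
lemma locallyUnique_of_eventually_frozen {n N κ : ℕ} {a : ℝ → ℝ} {M L : ℝ}
    (h : Admissible n N κ a M L) {p : St n N} {σ₀ : Fin N → Finset (Fin N)} {δ : ℝ} (hδ : 0 < δ)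
    (hσ : ∀ s ≤ δ, ∀ x, IsSelSol a κ M L s x → x 0 = p → ∀ r ∈ Ioc 0 s,
      ∀ σ, IsSel κ (x r) σ → frozen a σ (x r) = frozen a σ₀ (x r)) :
    LocallyUnique a κ M L p := by
  obtain ⟨K, hK⟩ := h.lipschitz
  obtain ⟨K', hK'⟩ := exists_frozen_lipschitzOnWith (n := n) (N := N) hK M
  refine ⟨δ, hδ, fun s hs x y hx hy hxp hyp r hr => ?_⟩
  rcases hr.1.eq_or_lt with h0 | hr0
  · rw [← h0, hxp, hyp]
  have key : ∀ η ∈ Ioo 0 r, dist (x r) (y r) ≤ dist (x η) (y η) * Real.exp (K' * (r - η)) := by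
    intro η hη
    have hsub : Icc η r ⊆ Icc 0 s := Icc_subset_Icc hη.1.le hr.2
    have hder : ∀ z, IsSelSol a κ M L s z → z 0 = p → ∀ t ∈ Ico η r,
        HasDerivWithinAt z (frozen a σ₀ (z t)) (Ici t) t := by
      intro z hz hzp t ht
      have hts : t ∈ Icc 0 s := hsub ⟨ht.1, ht.2.le⟩
      have hd := hz.hasDerivWithinAt hts (hσ s hs z hz hzp t ⟨hη.1.trans_le ht.1, hts.2⟩)
      refine (hd.mono (Icc_subset_Icc_left hts.1)).mono_of_mem_nhdsWithin ?_
      exact Icc_mem_nhdsGE (ht.2.trans_le hr.2)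
    exact dist_le_of_trajectories_ODE_of_mem (v := fun _ => frozen a σ₀)
      (s := fun _ => Metric.closedBall 0 M) (K := K') (fun t _ => hK' σ₀)
      (hx.continuousOn.mono hsub) (hder x hx hxp)
      (fun t ht => by simpa using hx.bound t (hsub ⟨ht.1, ht.2.le⟩))
      (hy.continuousOn.mono hsub) (hder y hy hyp)
      (fun t ht => by simpa using hy.bound t (hsub ⟨ht.1, ht.2.le⟩))
      le_rfl r ⟨hη.2.le, le_rfl⟩
  have h0s : (0 : ℝ) ∈ Icc 0 s := ⟨le_rfl, hr.1.trans hr.2⟩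
  have hI : Ioo 0 r ⊆ Icc 0 s := fun u hu => ⟨hu.1.le, hu.2.le.trans hr.2⟩
  have hlim : Tendsto (fun η => dist (x η) (y η) * Real.exp (K' * (r - η))) (𝓝[Ioo 0 r] 0)
      (𝓝 (dist (x 0) (y 0) * Real.exp (K' * (r - 0)))) := by
    refine Tendsto.mul (Tendsto.dist ?_ ?_) ?_
    · exact (hx.continuousOn 0 h0s).mono_left (nhdsWithin_mono _ hI)
    · exact (hy.continuousOn 0 h0s).mono_left (nhdsWithin_mono _ hI)
    · have : Continuous fun η : ℝ => Real.exp (K' * (r - η)) := by fun_prop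
      exact (this.tendsto 0).mono_left nhdsWithin_le_nhds
  rw [hxp, hyp, dist_self, zero_mul] at hlim
  have hne : NeBot (𝓝[Ioo 0 r] (0 : ℝ)) := left_nhdsWithin_Ioo_neBot hr0
  have := ge_of_tendsto hlim (by filter_upwards [self_mem_nhdsWithin] with η hη using key η hη)
  exact dist_le_zero.1 this

/-! ### Distances between agents -/

/-- The relative position `x_j - x_i`. -/
def relPos {n N : ℕ} (j i : Fin N) : St n N →L[ℝ] EuclideanSpace ℝ (Fin n) :=
  ContinuousLinearMap.proj (R := ℝ) (φ := fun _ : Fin N => EuclideanSpace ℝ (Fin n)) j -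
    ContinuousLinearMap.proj (R := ℝ) (φ := fun _ : Fin N => EuclideanSpace ℝ (Fin n)) i

@[simp] lemma relPos_apply {n N : ℕ} (j i : Fin N) (x : St n N) : relPos j i x = x j - x i := rfl

lemma norm_relPos_apply_le {n N : ℕ} (j i : Fin N) (x : St n N) : ‖x j - x i‖ ≤ 2 * ‖x‖ :=
  norm_apply_sub_le le_rfl j i

/-- Derivative of the squared distance between two agents. -/
def sqDistDeriv {n N : ℕ} (j i : Fin N) (x : St n N) : St n N →L[ℝ] ℝ :=
  (2 : ℝ) • (innerSL ℝ (x j - x i)).comp (relPos j i)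

lemma sqDistDeriv_apply {n N : ℕ} (j i : Fin N) (x v : St n N) :
    sqDistDeriv j i x v = 2 * inner ℝ (x j - x i) (v j - v i) := rfl

lemma hasStrictFDerivAt_sqDist {n N : ℕ} (j i : Fin N) (x : St n N) :
    HasStrictFDerivAt (fun y : St n N => ‖y j - y i‖ ^ 2) (sqDistDeriv j i x) x := by
  have h := (hasStrictFDerivAt_norm_sq (relPos j i x)).comp x (relPos (n := n) j i).hasStrictFDerivAt
  have e : sqDistDeriv j i x = (2 • innerSL ℝ (relPos j i x)).comp (relPos j i) := by
    ext v
    simp [sqDistDeriv, two_smul]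
  rw [e]
  exact h

lemma exists_inner_frozen_sub_ge {n N κ : ℕ} {a : ℝ → ℝ} {M L : ℝ}
    (h : Admissible n N κ a M L) :
    ∃ C : ℝ, 0 ≤ C ∧ ∀ x : St n N, ‖x‖ ≤ M → ∀ σ, IsSel κ x σ → ∀ j k,
      -C * ‖x j - x k‖ ^ 2 ≤ inner ℝ (frozen a σ x j - frozen a σ x k) (x j - x k) := by
  classical
  obtain ⟨K, hK⟩ := h.lipschitz
  obtain ⟨A, hA0, hA⟩ := exists_kernel_bound h.continuous (2 * M)
  have hM := h.radius_nonneg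
  refine ⟨2 * Fintype.card (Fin N) * (K * (2 * M) + A), by positivity, fun x hx σ hσ j k => ?_⟩
  have key := inner_sum_force_sub_ge hK h.nonneg hA x (x k) (x j) (R := 2 * M)
    (fun l => norm_apply_sub_le hx l k) (fun l => norm_apply_sub_le hx l j)
    (insert k (σ k)) (insert j (σ j))
    (by rw [Finset.card_insert_of_notMem (hσ k).1, Finset.card_insert_of_notMem (hσ j).1,
      (hσ k).2.1, (hσ j).2.1]) ?_ ?_
  · rw [Finset.sum_insert (hσ k).1, Finset.sum_insert (hσ j).1] at key
    simpa only [force, sub_self, smul_zero, zero_add, frozen] using key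
  · intro u hu v _ hv'
    rw [Finset.mem_insert, not_or] at hv'
    rcases Finset.mem_insert.1 hu with rfl | hu
    · simp
    · exact (hσ k).2.2 u hu v hv'.2 hv'.1
  · intro u hu v _ hv'
    rw [Finset.mem_insert, not_or] at hv'
    rcases Finset.mem_insert.1 hu with rfl | hu
    · simp
    · exact (hσ j).2.2 u hu v hv'.2 hv'.1

lemma IsSelSol.injective {n N κ : ℕ} {a : ℝ → ℝ} {M L T : ℝ} {x : ℝ → St n N}
    (h : Admissible n N κ a M L) (hx : IsSelSol a κ M L T x) (hinj : Function.Injective (x 0))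
    {t : ℝ} (ht : t ∈ Icc 0 T) : Function.Injective (x t) := by
  obtain ⟨C, hC0, hC⟩ := exists_inner_frozen_sub_ge h
  intro j k hjk
  by_contra hne
  set q₀ := ‖x 0 j - x 0 k‖ ^ 2
  have hq₀ : 0 < q₀ := by
    have := norm_pos_iff.2 (sub_ne_zero.2 fun h => hne (hinj h))
    positivity
  have hB : ∀ r : ℝ, HasDerivAt (fun r => q₀ * Real.exp (-(2 * C + 1) * r))
      (q₀ * (Real.exp (-(2 * C + 1) * r) * (-(2 * C + 1)))) r := by
    intro r
    have := ((hasDerivAt_id r).const_mul (-(2 * C + 1))).exp.const_mul q₀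
    simpa using this
  have := hx.barrier_le h.speed_nonneg le_rfl le_rfl
    (fun y => (hasStrictFDerivAt_sqDist j k y).hasFDerivAt) hB (by simp [q₀]) ?_ t ht
  · rw [hjk, sub_self, norm_zero] at this
    have h2 : 0 < q₀ * Real.exp (-(2 * C + 1) * t) := by positivity
    rw [zero_pow two_ne_zero] at this
    exact absurd this (not_le.2 h2)
  · intro r hr heq σ hσ
    have h1 := hC (x r) (hx.bound r ⟨hr.1, hr.2.le⟩) σ hσ j k
    rw [heq] at h1
    rw [sqDistDeriv_apply, real_inner_comm]
    have h2 : 0 < q₀ * Real.exp (-(2 * C + 1) * r) := by positivity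
    nlinarith

/-- Difference of the squared distances of `j` and `k` to the agent `i`. -/
def gap {n N : ℕ} (i j k : Fin N) (x : St n N) : ℝ := ‖x j - x i‖ ^ 2 - ‖x k - x i‖ ^ 2

/-- Derivative of `gap`. -/
def gapDeriv {n N : ℕ} (i j k : Fin N) (x : St n N) : St n N →L[ℝ] ℝ :=
  sqDistDeriv j i x - sqDistDeriv k i x

lemma gapDeriv_apply {n N : ℕ} (i j k : Fin N) (x v : St n N) :
    gapDeriv i j k x v = 2 * inner ℝ (x j - x i) (v j - v i) - 2 * inner ℝ (x k - x i) (v k - v i) := by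
  rw [gapDeriv, sub_apply, sqDistDeriv_apply, sqDistDeriv_apply]

lemma hasStrictFDerivAt_gap {n N : ℕ} (i j k : Fin N) (x : St n N) :
    HasStrictFDerivAt (gap i j k) (gapDeriv i j k x) x :=
  (hasStrictFDerivAt_sqDist j i x).sub (hasStrictFDerivAt_sqDist k i x)

lemma gap_swap {n N : ℕ} (i j k : Fin N) (x : St n N) : gap i k j x = -gap i j k x := by
  simp [gap]

lemma gapDeriv_swap {n N : ℕ} (i j k : Fin N) (x v : St n N) :
    gapDeriv i k j x v = -gapDeriv i j k x v := by
  simp [gapDeriv]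

lemma gap_eq_zero_iff {n N : ℕ} (i j k : Fin N) (x : St n N) :
    gap i j k x = 0 ↔ ‖x j - x i‖ = ‖x k - x i‖ := by
  rw [gap, sub_eq_zero, sq_eq_sq₀ (norm_nonneg _) (norm_nonneg _)]

lemma exists_abs_gapDeriv_frozen_sub_le {n N κ : ℕ} {a : ℝ → ℝ} {M L : ℝ}
    (h : Admissible n N κ a M L) : ∃ C : ℝ, 0 ≤ C ∧ ∀ (i j k : Fin N) (σ) (x y : St n N),
      ‖x‖ ≤ M → ‖y‖ ≤ M → |gapDeriv i j k x (frozen a σ x) - gapDeriv i j k y (frozen a σ y)|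
        ≤ C * ‖x - y‖ := by
  obtain ⟨K, hK⟩ := h.lipschitz
  obtain ⟨K', hK'⟩ := exists_frozen_lipschitzOnWith (n := n) (N := N) hK M
  have hM := h.radius_nonneg
  have hL := h.speed_nonneg
  have hone : ∀ (j i : Fin N) (σ) (x y : St n N), ‖x‖ ≤ M → ‖y‖ ≤ M →
      |sqDistDeriv j i x (frozen a σ x) - sqDistDeriv j i y (frozen a σ y)|
        ≤ (8 * L + 8 * M * K') * ‖x - y‖ := by
    intro j i σ x y hx hy
    set v := frozen a σ x
    set w := frozen a σ y
    have hv : ‖v‖ ≤ L := h.speed' σ x hx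
    have hvw : ‖v - w‖ ≤ K' * ‖x - y‖ := by
      have := (hK' σ).dist_le_mul x (by simpa using hx) y (by simpa using hy)
      rwa [dist_eq_norm, dist_eq_norm] at this
    have e : sqDistDeriv j i x v - sqDistDeriv j i y w =
        2 * inner ℝ ((x - y) j - (x - y) i) (v j - v i)
          + 2 * inner ℝ (y j - y i) ((v - w) j - (v - w) i) := by
      have e1 : (x - y) j - (x - y) i = (x j - x i) - (y j - y i) := by
        simp only [Pi.sub_apply]; abel
      have e2 : (v - w) j - (v - w) i = (v j - v i) - (w j - w i) := by
        simp only [Pi.sub_apply]; abel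
      rw [sqDistDeriv_apply, sqDistDeriv_apply, e1, e2, inner_sub_left (x j - x i) (y j - y i),
        inner_sub_right (y j - y i) (v j - v i)]
      ring
    rw [e]
    have h1 := abs_real_inner_le_norm ((x - y) j - (x - y) i) (v j - v i)
    have h2 := abs_real_inner_le_norm (y j - y i) ((v - w) j - (v - w) i)
    have h3 : ‖(x - y) j - (x - y) i‖ * ‖v j - v i‖ ≤ (2 * ‖x - y‖) * (2 * L) := by
      gcongr
      · exact norm_relPos_apply_le j i (x - y)
      · exact norm_apply_sub_le hv j i
    have h4 : ‖y j - y i‖ * ‖(v - w) j - (v - w) i‖ ≤ (2 * M) * (2 * (K' * ‖x - y‖)) := by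
      gcongr
      · exact norm_apply_sub_le hy j i
      · exact norm_apply_sub_le hvw j i
    refine (abs_add_le _ _).trans ?_
    rw [abs_mul, abs_mul, abs_two]
    linarith
  refine ⟨2 * (8 * L + 8 * M * K'), by positivity, fun i j k σ x y hx hy => ?_⟩
  have h1 := hone j i σ x y hx hy
  have h2 := hone k i σ x y hx hy
  rw [gapDeriv, gapDeriv, sub_apply, sub_apply]
  rw [abs_le] at *
  constructor <;> linarith [h1.1, h1.2, h2.1, h2.2]

section GapSingle

variable {n N : ℕ} {i j k : Fin N} (x : St n N) (w : EuclideanSpace ℝ (Fin n))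

lemma gapDeriv_single_center (hj : j ≠ i) (hk : k ≠ i) :
    gapDeriv i j k x (Pi.single i w) = 2 * inner ℝ (x k - x j) w := by
  rw [gapDeriv_apply, Pi.single_eq_same, Pi.single_eq_of_ne hj, Pi.single_eq_of_ne hk, zero_sub,
    inner_neg_right, inner_neg_right, inner_sub_left, inner_sub_left, inner_sub_left]
  ring

lemma gapDeriv_single_left (hj : j ≠ i) (hjk : j ≠ k) :
    gapDeriv i j k x (Pi.single j w) = 2 * inner ℝ (x j - x i) w := by
  rw [gapDeriv_apply, Pi.single_eq_same, Pi.single_eq_of_ne hj.symm, Pi.single_eq_of_ne hjk.symm]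
  simp

lemma gapDeriv_single_right (hk : k ≠ i) (hjk : j ≠ k) :
    gapDeriv i j k x (Pi.single k w) = -2 * inner ℝ (x k - x i) w := by
  rw [gapDeriv_apply, Pi.single_eq_same, Pi.single_eq_of_ne hk.symm, Pi.single_eq_of_ne hjk]
  simp

lemma gapDeriv_single_other {u : Fin N} (hi : u ≠ i) (hj : u ≠ j) (hk : u ≠ k) :
    gapDeriv i j k x (Pi.single u w) = 0 := by
  rw [gapDeriv_apply, Pi.single_eq_of_ne hi.symm, Pi.single_eq_of_ne hj.symm,
    Pi.single_eq_of_ne hk.symm]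
  simp

variable {x}

lemma exists_gapDeriv_single_ne_zero (hx : Function.Injective x) (hj : j ≠ i) (hk : k ≠ i)
    (hjk : j ≠ k) {u : Fin N} (hu : u = i ∨ u = j ∨ u = k) :
    ∃ w, gapDeriv i j k x (Pi.single u w) ≠ 0 := by
  have hne : ∀ {u v : Fin N}, u ≠ v → inner ℝ (x u - x v) (x u - x v) ≠ (0 : ℝ) :=
    fun h h0 => h (hx (sub_eq_zero.1 (inner_self_eq_zero.1 h0)))
  rcases hu with rfl | rfl | rfl
  · exact ⟨x k - x j, by
      rw [gapDeriv_single_center _ _ hj hk]; exact mul_ne_zero two_ne_zero (hne hjk.symm)⟩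
  · exact ⟨x u - x i, by
      rw [gapDeriv_single_left _ _ hj hjk]; exact mul_ne_zero two_ne_zero (hne hj)⟩
  · exact ⟨x u - x i, by
      rw [gapDeriv_single_right _ _ hk hjk]; exact mul_ne_zero (by norm_num) (hne hk)⟩

end GapSingle

/-- In an equilateral triangle, two ties with different centres are independent. -/
lemma eq_zero_of_equilateral {V : Type*} [NormedAddCommGroup V] [InnerProductSpace ℝ V]
    {u w : V} {α β : ℝ} (hu : u ≠ 0) (h1 : ‖u‖ = ‖w‖) (h2 : ‖w - u‖ = ‖u‖)
    (h : ∀ z, α * inner ℝ u z + β * inner ℝ w z = 0) : α = 0 ∧ β = 0 := by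
  have e := norm_sub_sq_real w u
  rw [h2, ← h1, real_inner_comm] at e
  have hu0 : 0 < ‖u‖ ^ 2 := by have := norm_pos_iff.2 hu; positivity
  have e1 := h u
  have e2 := h w
  rw [real_inner_self_eq_norm_sq, real_inner_comm] at e1
  rw [real_inner_self_eq_norm_sq, ← h1] at e2
  have h3 : inner ℝ u w = ‖u‖ ^ 2 / 2 := by linarith
  rw [h3] at e1 e2
  have h4 : α + β / 2 = 0 := by
    have : (α + β / 2) * ‖u‖ ^ 2 = 0 := by linarith
    exact (mul_eq_zero.1 this).resolve_right hu0.ne'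
  have h5 : α / 2 + β = 0 := by
    have : (α / 2 + β) * ‖u‖ ^ 2 = 0 := by linarith
    exact (mul_eq_zero.1 this).resolve_right hu0.ne'
  constructor <;> linarith

lemma gapDeriv_independent {n N : ℕ} {i j k i' j' k' : Fin N} {p : St n N}
    (hp : Function.Injective p) (hj : j ≠ i) (hk : k ≠ i) (hjk : j ≠ k)
    (hj' : j' ≠ i') (hk' : k' ≠ i') (hjk' : j' ≠ k')
    (h0 : gap i j k p = 0) (h0' : gap i' j' k' p = 0)
    (hne : ¬ (i' = i ∧ (j' = j ∧ k' = k ∨ j' = k ∧ k' = j))) {α β : ℝ}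
    (H : ∀ v, α * gapDeriv i j k p v + β * gapDeriv i' j' k' p v = 0) : α = 0 ∧ β = 0 := by
  by_cases hset : ∃ u, (u = i ∨ u = j ∨ u = k) ∧ u ≠ i' ∧ u ≠ j' ∧ u ≠ k'
  · obtain ⟨u, hu, hu1, hu2, hu3⟩ := hset
    obtain ⟨w, hw⟩ := exists_gapDeriv_single_ne_zero hp hj hk hjk hu
    have h1 := H (Pi.single u w)
    rw [gapDeriv_single_other _ _ hu1 hu2 hu3, mul_zero, add_zero] at h1
    have hα := (mul_eq_zero.1 h1).resolve_right hw
    obtain ⟨w', hw'⟩ := exists_gapDeriv_single_ne_zero hp hj' hk' hjk' (Or.inl rfl)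
    have h2 := H (Pi.single i' w')
    rw [hα, zero_mul, zero_add] at h2
    exact ⟨hα, (mul_eq_zero.1 h2).resolve_right hw'⟩
  · push Not at hset
    have key : ∀ {i j k : Fin N} {α β : ℝ}, j ≠ i → k ≠ i → j ≠ k → gap i j k p = 0 →
        gap j i k p = 0 → (∀ v, α * gapDeriv i j k p v + β * gapDeriv j i k p v = 0) →
        α = 0 ∧ β = 0 := by
      intro i j k α β hj hk hjk h0 h0' H
      rw [gap_eq_zero_iff] at h0 h0'
      refine eq_zero_of_equilateral (u := p k - p i) (w := p k - p j)
        (sub_ne_zero.2 fun h => hk (hp h)) ?_ ?_ fun z => ?_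
      · rw [← h0, ← h0', norm_sub_rev]
      · rw [sub_sub_sub_cancel_left, ← h0, norm_sub_rev]
      · have := H (Pi.single k z)
        rw [gapDeriv_single_right _ _ hk hjk, gapDeriv_single_right _ _ hjk.symm hk.symm] at this
        linarith
    have hi1 := hset i (Or.inl rfl)
    have hj1 := hset j (Or.inr (Or.inl rfl))
    have hk1 := hset k (Or.inr (Or.inr rfl))
    have hcases : (i' = j ∧ j' = i ∧ k' = k) ∨ (i' = j ∧ k' = i ∧ j' = k) ∨
        (i' = k ∧ j' = i ∧ k' = j) ∨ (i' = k ∧ k' = i ∧ j' = j) := by grind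
    rcases hcases with ⟨rfl, rfl, rfl⟩ | ⟨rfl, rfl, rfl⟩ | ⟨rfl, rfl, rfl⟩ | ⟨rfl, rfl, rfl⟩
    · exact key hj hk hjk h0 h0' H
    · have := key (α := α) (β := -β) hj hk hjk h0 (by rw [gap_swap, h0', neg_zero]) fun v => by
        rw [gapDeriv_swap i' j' k']; linarith [H v]
      exact ⟨this.1, by linarith [this.2]⟩
    · have := key (α := -α) (β := β) hk hj hjk.symm (by rw [gap_swap, h0, neg_zero]) h0' fun v => by
        rw [gapDeriv_swap j' k' i']; linarith [H v]
      exact ⟨by linarith [this.1], this.2⟩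
    · have := key (α := -α) (β := -β) hk hj hjk.symm (by rw [gap_swap, h0, neg_zero])
        (by rw [gap_swap, h0', neg_zero]) fun v => by
        rw [gapDeriv_swap k' j' i', gapDeriv_swap i' j' k']; linarith [H v]
      exact ⟨by linarith [this.1], by linarith [this.2]⟩

/-- Near a point where `F` is a strict submersion, the sublevel sets `{‖F‖ < ε}` have measure
of order `ε` to the dimension of the codomain. -/
lemma exists_isOpen_addHaar_le {E G : Type*} [NormedAddCommGroup E] [NormedSpace ℝ E]
    [FiniteDimensional ℝ E] [MeasurableSpace E] [BorelSpace E] (μ : Measure E)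
    [μ.IsAddHaarMeasure] [NormedAddCommGroup G] [NormedSpace ℝ G] [FiniteDimensional ℝ G]
    {F : E → G} {F' : E →L[ℝ] G} {p : E} (hF : HasStrictFDerivAt F F' p) (hF' : F'.range = ⊤) :
    ∃ O : Set E, IsOpen O ∧ p ∈ O ∧ ∃ B : ℝ, ∀ ε, 0 < ε →
      μ (O ∩ {y | ‖F y‖ < ε}) ≤ ENNReal.ofReal (B * ε ^ Module.finrank ℝ G) := by
  have : CompleteSpace E := FiniteDimensional.complete ℝ E
  have : CompleteSpace G := FiniteDimensional.complete ℝ G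
  let Z := F'.ker
  have : CompleteSpace Z := FiniteDimensional.complete ℝ Z
  let φ := hF.implicitFunctionDataOfComplemented F F' hF'
    (ContinuousLinearMap.ker_closedComplemented_of_finiteDimensional_range F')
  let _ : MeasurableSpace G := borel G
  have : BorelSpace G := ⟨rfl⟩
  let _ : MeasurableSpace Z := borel Z
  have : BorelSpace Z := ⟨rfl⟩
  let ν : Measure (G × Z) := (Measure.addHaar : Measure G).prod (Measure.addHaar : Measure Z)
  let e : E ≃L[ℝ] G × Z := φ.leftDeriv.equivProdOfSurjectiveOfIsCompl φ.rightDeriv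
    φ.range_leftDeriv φ.range_rightDeriv φ.isCompl_ker
  have hd : Module.finrank ℝ E = Module.finrank ℝ (G × Z) := e.toLinearEquiv.finrank_eq
  have hstrict : HasStrictFDerivAt φ.prodFun (e : E →L[ℝ] G × Z) p := φ.hasStrictFDerivAt
  obtain ⟨s, hps, hso, hs⟩ := hstrict.approximates_deriv_on_open_nhds
  have hanti := hs.antilipschitz (e.subsingleton_or_nnnorm_symm_pos.imp id fun h =>
    NNReal.half_lt_self (inv_ne_zero h.ne'))
  obtain ⟨C, hC⟩ := exists_addHaar_le_of_expanding μ ν hd (s := s) (φ := φ.prodFun)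
    fun x hx y hy => hanti ⟨x, hx⟩ ⟨y, hy⟩
  have hcont : ContinuousAt φ.rightFun p := φ.hasStrictFDerivAt_rightFun.continuousAt
  have hbd : ∀ᶠ y in 𝓝 p, φ.rightFun y ∈ Metric.ball (φ.rightFun p) 1 :=
    hcont (Metric.ball_mem_nhds _ one_pos)
  obtain ⟨s', hs', hs'o, hps'⟩ := eventually_nhds_iff.1 hbd
  refine ⟨s ∩ s', hso.inter hs'o, ⟨hps, hps'⟩,
    C * ((Measure.addHaar (Metric.ball (0 : G) 1)).toReal *
      (Measure.addHaar (Metric.ball (φ.rightFun p) 1)).toReal), fun ε hε => ?_⟩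
  refine (hC _ (fun y hy => hy.1.1) (Metric.ball (0 : G) ε ×ˢ Metric.ball (φ.rightFun p) 1)
    fun y hy => ⟨mem_ball_zero_iff.2 hy.2, hs' y hy.1.2⟩).trans ?_
  rw [Measure.prod_prod, Measure.addHaar_ball_of_pos _ _ hε]
  have h1 : (Measure.addHaar (Metric.ball (0 : G) 1)) ≠ ∞ := measure_ball_lt_top.ne
  have h2 : (Measure.addHaar (Metric.ball (φ.rightFun p) 1)) ≠ ∞ := measure_ball_lt_top.ne
  rw [ENNReal.ofReal_mul (by positivity), ENNReal.ofReal_mul (by positivity),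
    ENNReal.ofReal_mul (by positivity), ENNReal.ofReal_toReal h1, ENNReal.ofReal_toReal h2,
    ENNReal.ofReal_coe_nnreal]
  apply le_of_eq
  ring

lemma exists_isOpen_abs_gap_lt {n N : ℕ} {i j k : Fin N} {p : St n N}
    (hp : Function.Injective p) (hj : j ≠ i) (hk : k ≠ i) (hjk : j ≠ k) :
    ∃ O : Set (St n N), IsOpen O ∧ p ∈ O ∧ ∃ B : ℝ, ∀ ε, 0 < ε →
      volume (O ∩ {y | |gap i j k y| < ε}) ≤ ENNReal.ofReal (B * ε) := by
  obtain ⟨w, hw⟩ := exists_gapDeriv_single_ne_zero hp hj hk hjk (Or.inl rfl)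
  have hsurj : (gapDeriv i j k p).range = ⊤ := by
    refine LinearMap.range_eq_top.2 (LinearMap.surjective fun h => hw ?_)
    exact congrArg (fun f : St n N →ₗ[ℝ] ℝ => f (Pi.single i w)) h
  have := exists_isOpen_addHaar_le volume (hasStrictFDerivAt_gap i j k p) hsurj
  simpa using this

lemma exists_isOpen_abs_gap_lt_and {n N : ℕ} {i j k i' j' k' : Fin N} {p : St n N}
    (hp : Function.Injective p) (hj : j ≠ i) (hk : k ≠ i) (hjk : j ≠ k)
    (hj' : j' ≠ i') (hk' : k' ≠ i') (hjk' : j' ≠ k')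
    (h0 : gap i j k p = 0) (h0' : gap i' j' k' p = 0)
    (hne : ¬ (i' = i ∧ (j' = j ∧ k' = k ∨ j' = k ∧ k' = j))) :
    ∃ O : Set (St n N), IsOpen O ∧ p ∈ O ∧ ∃ B : ℝ, ∀ ε, 0 < ε →
      volume (O ∩ {y | |gap i j k y| < ε ∧ |gap i' j' k' y| < ε}) ≤
        ENNReal.ofReal (B * ε ^ 2) := by
  have hsurj : ((gapDeriv i j k p).prod (gapDeriv i' j' k' p)).range = ⊤ := by
    by_contra hlt
    obtain ⟨f, hf, hle⟩ := Submodule.exists_le_ker_of_lt_top _ (lt_top_iff_ne_top.2 hlt)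
    have hfe : ∀ z : ℝ × ℝ, f z = f (1, 0) * z.1 + f (0, 1) * z.2 := by
      intro z
      have : z = z.1 • ((1, 0) : ℝ × ℝ) + z.2 • ((0, 1) : ℝ × ℝ) := by ext <;> simp
      conv_lhs => rw [this, map_add, map_smul, map_smul]
      simp only [smul_eq_mul]
      ring
    have := gapDeriv_independent hp hj hk hjk hj' hk' hjk' h0 h0' hne (α := f (1, 0))
      (β := f (0, 1)) fun v => by
        rw [← hfe (gapDeriv i j k p v, gapDeriv i' j' k' p v)]
        exact hle ⟨v, rfl⟩
    refine hf (LinearMap.ext fun z => ?_)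
    rw [hfe, this.1, this.2]
    simp
  have := exists_isOpen_addHaar_le volume
    ((hasStrictFDerivAt_gap i j k p).prodMk (hasStrictFDerivAt_gap i' j' k' p)) hsurj
  simpa [Prod.norm_def] using this

/-! ### Ties between neighbors -/

lemma IsSelSol.norm_sub_le {n N κ : ℕ} {a : ℝ → ℝ} {M L T s t : ℝ} {x : ℝ → St n N}
    (hx : IsSelSol a κ M L T x) (hs : 0 ≤ s) (hst : s ≤ t) (ht : t ≤ T) :
    ‖x t - x s‖ ≤ L * (t - s) := by
  have := hx.lip s ⟨hs, hst.trans ht⟩ t ⟨hs.trans hst, ht⟩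
  rwa [abs_of_nonneg (by linarith)] at this

/-- A property of points near `p` holds along all solutions issued from `p`, for short times. -/
lemma exists_forall_isSelSol_of_eventually {n N κ : ℕ} {a : ℝ → ℝ} {M L : ℝ} (hL : 0 ≤ L)
    {p : St n N} {P : St n N → Prop} (hP : ∀ᶠ y in 𝓝 p, P y) :
    ∃ δ > 0, ∀ T t x, IsSelSol a κ M L T x → ∀ s ∈ Icc 0 T, ∀ r ∈ Icc 0 T, x s = p →
      (r - s = t ∨ s - r = t) → 0 ≤ t → t < δ → P (x r) := by
  obtain ⟨η, hη, H⟩ := Metric.eventually_nhds_iff.1 hP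
  refine ⟨η / (L + 1), by positivity, fun T t x hx s hs r hr hsp hrs ht htδ => H ?_⟩
  rw [dist_eq_norm, ← hsp]
  have h1 := hx.lip s hs r hr
  have h2 : |r - s| = t := by
    rcases hrs with h | h
    · rw [h, abs_of_nonneg ht]
    · rw [abs_sub_comm, h, abs_of_nonneg ht]
  rw [h2] at h1
  rw [lt_div_iff₀ (by linarith)] at htδ
  nlinarith

lemma locallyUnique_of_subsingleton {n N κ : ℕ} {a : ℝ → ℝ} {M L : ℝ}
    (h : Admissible n N κ a M L) {p : St n N}
    (hp : ∀ i S S', IsNbrSet κ p i S → IsNbrSet κ p i S' → S = S') :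
    LocallyUnique a κ M L p := by
  obtain ⟨δ, hδ, H⟩ := exists_forall_isSelSol_of_eventually (κ := κ) (a := a) (M := M)
    h.speed_nonneg (eventually_isSel_imp (κ := κ) p)
  refine locallyUnique_of_eventually_frozen h (σ₀ := topoNbrs κ p) (half_pos hδ)
    fun s hs x hx hxp r hr σ hσ => ?_
  have h1 := H s r x hx 0 ⟨le_rfl, hr.1.le.trans hr.2⟩ r ⟨hr.1.le, hr.2⟩ hxp
    (Or.inl (sub_zero r)) hr.1.le (by linarith [hr.2]) σ hσ
  have : σ = topoNbrs κ p := funext fun i => hp i _ _ (h1 i) (isNbrSet_topoNbrs h.le_pred p i)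
  rw [this]

/-- Near `p`, the only ambiguity in the choice of neighbors is whether the agent `i` interacts
with `k` (selection `P`) or with `j` (selection `Q`). -/
structure SimpleTie {n N : ℕ} (a : ℝ → ℝ) (κ : ℕ) (p : St n N) (i j k : Fin N)
    (P Q : Fin N → Finset (Fin N)) : Prop where
  gap_eq : gap i j k p = 0
  sel : ∀ᶠ y in 𝓝 p, ∀ σ, IsSel κ y σ → (σ = P ∧ 0 ≤ gap i j k y) ∨ (σ = Q ∧ gap i j k y ≤ 0)
  mono : gapDeriv i j k p (frozen a Q p) ≤ gapDeriv i j k p (frozen a P p)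

lemma SimpleTie.swap {n N κ : ℕ} {a : ℝ → ℝ} {p : St n N} {i j k : Fin N}
    {P Q : Fin N → Finset (Fin N)} (h : SimpleTie a κ p i j k P Q) :
    SimpleTie a κ p i k j Q P where
  gap_eq := by rw [gap_swap, h.gap_eq, neg_zero]
  sel := by
    filter_upwards [h.sel] with y hy σ hσ
    rw [gap_swap, neg_nonneg, neg_nonpos]
    exact (hy σ hσ).symm
  mono := by
    rw [gapDeriv_swap i j k, gapDeriv_swap i j k]
    exact neg_le_neg h.mono

lemma exists_simpleTie {n N κ : ℕ} {a : ℝ → ℝ} (hκ : κ ≤ N - 1) (ha : ∀ r, 0 ≤ a r) {p : St n N}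
    {i : Fin N} {S S' : Finset (Fin N)} (hS : IsNbrSet κ p i S) (hS' : IsNbrSet κ p i S')
    (hne : S ≠ S') :
    ∃ j k, j ≠ i ∧ k ≠ i ∧ j ≠ k ∧ gap i j k p = 0 ∧
      ((∀ i' j' k', j' ≠ i' → k' ≠ i' → j' ≠ k' → gap i' j' k' p = 0 →
        i' = i ∧ (j' = j ∧ k' = k ∨ j' = k ∧ k' = j)) →
      ∃ P Q, SimpleTie a κ p i j k P Q) := by
  classical
  obtain ⟨⟨j, hj, hj'⟩, k, hk, hk'⟩ :=
    exists_mem_sdiff_of_card_eq (hS.2.1.trans hS'.2.1.symm) hne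
  obtain ⟨hji, hki, hjk, hd⟩ := hS.tie hS' hj hj' hk hk'
  have hgap := (gap_eq_zero_iff i j k p).2 hd
  refine ⟨j, k, hji, hki, hjk, hgap, fun huniq => ?_⟩
  have tie : ∀ {i' R R' u v}, IsNbrSet κ p i' R → IsNbrSet κ p i' R' → u ∈ R → u ∉ R' →
      v ∈ R' → v ∉ R → i' = i ∧ (u = j ∧ v = k ∨ u = k ∧ v = j) := by
    intro i' R R' u v hR hR' hu hu' hv hv'
    obtain ⟨h1, h2, h3, h4⟩ := hR.tie hR' hu hu' hv hv'
    exact huniq i' u v h1 h2 h3 ((gap_eq_zero_iff _ _ _ _).2 h4)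
  have alt : ∀ R, IsNbrSet κ p i R → R = S ∨ R = S' := by
    intro R hR
    by_contra! hcon
    obtain ⟨⟨u, hu, hu'⟩, v, hv, hv'⟩ :=
      exists_mem_sdiff_of_card_eq (hR.2.1.trans hS.2.1.symm) hcon.1
    obtain ⟨⟨w, hw, hw'⟩, z, hz, hz'⟩ :=
      exists_mem_sdiff_of_card_eq (hR.2.1.trans hS'.2.1.symm) hcon.2
    have h1 := (tie hR hS hu hu' hv hv').2
    have h2 := (tie hR hS' hw hw' hz hz').2
    grind
  have other : ∀ i', i' ≠ i → ∀ R R', IsNbrSet κ p i' R → IsNbrSet κ p i' R' → R = R' := by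
    intro i' hi' R R' hR hR'
    by_contra hcon
    obtain ⟨⟨u, hu, hu'⟩, v, hv, hv'⟩ :=
      exists_mem_sdiff_of_card_eq (hR.2.1.trans hR'.2.1.symm) hcon
    exact hi' (tie hR hR' hu hu' hv hv').1
  set σ₀ := topoNbrs κ p
  have sel : ∀ σ, IsSel κ p σ → ∀ R, σ i = R → σ = Function.update σ₀ i R := by
    intro σ hσ R hR
    funext l
    by_cases hl : l = i
    · subst hl; simp [hR]
    · rw [Function.update_of_ne hl]
      exact other l hl _ _ (hσ l) (isNbrSet_topoNbrs hκ p l)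
  refine ⟨Function.update σ₀ i S', Function.update σ₀ i S, hgap, ?_, ?_⟩
  · filter_upwards [eventually_isSel_imp (κ := κ) p] with y hy σ hσ
    have hσp := hy σ hσ
    rcases alt (σ i) (hσp i) with hR | hR
    · refine Or.inr ⟨sel σ hσp S hR, ?_⟩
      have := (hσ i).2.2 j (hR ▸ hj) k (hR ▸ hk') hki
      rw [gap, sub_nonpos]
      gcongr
    · refine Or.inl ⟨sel σ hσp S' hR, ?_⟩
      have := (hσ i).2.2 k (hR ▸ hk) j (hR ▸ hj') hji
      rw [gap, sub_nonneg]
      gcongr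
  · have hSS' : S' = insert k (S.erase j) := by
      ext u
      rw [Finset.mem_insert, Finset.mem_erase]
      constructor
      · intro hu
        by_cases huS : u ∈ S
        · exact Or.inr ⟨fun h => hj' (h ▸ hu), huS⟩
        · have := (tie hS hS' hj hj' hu huS).2
          grind
      · rintro (rfl | ⟨huj, hu⟩)
        · exact hk
        · by_contra huS
          have := (tie hS hS' hu huS hk hk').2
          grind
    have hsum : ∑ l ∈ S', a ‖p l - p i‖ • (p l - p i) =
        ∑ l ∈ S, a ‖p l - p i‖ • (p l - p i) + a ‖p k - p i‖ • (p k - p j) := by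
      rw [hSS', Finset.sum_insert (by simp [hk']), ← Finset.add_sum_erase S _ hj, hd]
      module
    have hfr : frozen a (Function.update σ₀ i S') p =
        frozen a (Function.update σ₀ i S) p + Pi.single i (a ‖p k - p i‖ • (p k - p j)) := by
      funext l
      by_cases hl : l = i
      · subst hl
        simp [frozen, hsum]
      · simp [frozen, hl]
    rw [hfr, map_add, gapDeriv_single_center _ _ hji hki, real_inner_smul_right]
    have h1 := ha ‖p k - p i‖
    have h2 := real_inner_self_nonneg (x := p k - p j) (F := EuclideanSpace ℝ (Fin n))
    have := mul_nonneg h1 h2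
    linarith

lemma SimpleTie.locallyUnique {n N κ : ℕ} {a : ℝ → ℝ} {M L : ℝ} (h : Admissible n N κ a M L)
    {p : St n N} (hp : ‖p‖ ≤ M) {i j k : Fin N} {P Q : Fin N → Finset (Fin N)}
    (ht : SimpleTie a κ p i j k P Q) (hpos : 0 < gapDeriv i j k p (frozen a Q p)) :
    LocallyUnique a κ M L p := by
  obtain ⟨C, hC0, hC⟩ := exists_abs_gapDeriv_frozen_sub_le h
  have hL := h.speed_nonneg
  set c := gapDeriv i j k p (frozen a Q p) / 2 with hc
  have hc0 : 0 < c := half_pos hpos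
  obtain ⟨δ, hδ, H⟩ := exists_forall_isSelSol_of_eventually (κ := κ) (a := a) (M := M) hL ht.sel
  have hδ' : 0 < min (δ / 2) (c / (2 * (C * L + 1))) := by positivity
  refine locallyUnique_of_eventually_frozen h (σ₀ := P) hδ' fun s hs x hx hxp => ?_
  have hsel : ∀ r ∈ Icc 0 s, ∀ σ, IsSel κ (x r) σ →
      (σ = P ∧ 0 ≤ gap i j k (x r)) ∨ (σ = Q ∧ gap i j k (x r) ≤ 0) := fun r hr =>
    H s r x hx 0 ⟨le_rfl, hr.1.trans hr.2⟩ r hr hxp (Or.inl (sub_zero r)) hr.1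
      (by linarith [hr.2, hs.trans (min_le_left _ _)])
  have hbar := hx.barrier_le hL le_rfl le_rfl
    (fun y => (hasStrictFDerivAt_gap i j k y).hasFDerivAt) (B := fun r => c * r)
    (B' := fun _ => c) (fun r => by simpa using (hasDerivAt_id r).const_mul c)
    (by rw [hxp, ht.gap_eq, mul_zero]) ?_
  · intro r hr σ hσ
    have h1 : c * r ≤ gap i j k (x r) := hbar r ⟨hr.1.le, hr.2⟩
    have h2 : 0 < c * r := mul_pos hc0 hr.1
    rcases hsel r ⟨hr.1.le, hr.2⟩ σ hσ with h3 | h3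
    · rw [h3.1]
    · exact absurd h3.2 (by linarith)
  · intro r hr _ σ hσ
    have hrI : r ∈ Icc 0 s := ⟨hr.1, hr.2.le⟩
    have h1 := hC i j k σ (x r) p (hx.bound r hrI) hp
    have h2 : ‖x r - p‖ ≤ L * r := by
      have := hx.norm_sub_le le_rfl hr.1 hr.2.le
      rwa [hxp, sub_zero] at this
    have h3 : r * (2 * (C * L + 1)) < c := by
      rw [← lt_div_iff₀ (by positivity)]
      exact hr.2.trans_le (hs.trans (min_le_right _ _))
    have h4 : C * ‖x r - p‖ ≤ C * L * r := by
      rw [mul_assoc]; gcongr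
    have h5 : 2 * c ≤ gapDeriv i j k p (frozen a σ p) := by
      have : 2 * c = gapDeriv i j k p (frozen a Q p) := by rw [hc]; ring
      rcases hsel r hrI σ hσ with h3 | h3
      · rw [h3.1, this]; exact ht.mono
      · rw [h3.1, this]
    have h6 := (abs_le.1 h1).1
    have h7 : 0 ≤ C * L * r := mul_nonneg (mul_nonneg hC0 hL) hr.1
    nlinarith [hr.1]

lemma SimpleTie.exists_gap_le {n N κ : ℕ} {a : ℝ → ℝ} {M L : ℝ} (h : Admissible n N κ a M L)
    {p : St n N} {i j k : Fin N} {P Q : Fin N → Finset (Fin N)}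
    (ht : SimpleTie a κ p i j k P Q) (hnonneg : 0 ≤ gapDeriv i j k p (frozen a P p)) :
    ∃ C : ℝ, ∃ δ > 0, ∀ τ x, IsSelSol a κ M L τ x → x τ = p → ∀ t ∈ Icc 0 τ, τ - t < δ →
      gap i j k (x t) ≤ C * (τ - t) ^ 2 := by
  obtain ⟨C, hC0, hC⟩ := exists_abs_gapDeriv_frozen_sub_le h
  have hL := h.speed_nonneg
  set A := (C * L + 1) / 2 with hA
  have hA0 : 0 < A := by positivity
  obtain ⟨δ, hδ, H⟩ := exists_forall_isSelSol_of_eventually (κ := κ) (a := a) (M := M) hL ht.sel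
  refine ⟨A, δ, hδ, fun τ x hx hxp t htI htδ => ?_⟩
  by_contra! hlt
  have hτ : τ ∈ Icc 0 τ := ⟨htI.1.trans htI.2, le_rfl⟩
  have hB : ∀ r : ℝ, HasDerivAt
      (fun r => gap i j k (x t) - A * (τ - t) ^ 2 + A * (τ - r) ^ 2) (-(2 * A * (τ - r))) r := by
    intro r
    have := ((((hasDerivAt_id r).const_sub τ).pow 2).const_mul A).const_add
      (gap i j k (x t) - A * (τ - t) ^ 2)
    refine HasDerivAt.congr_deriv this ?_
    simp
    ring
  have := hx.barrier_le hL htI.1 le_rfl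
    (fun y => (hasStrictFDerivAt_gap i j k y).hasFDerivAt) hB (by linarith) ?_ τ ⟨htI.2, le_rfl⟩
  · rw [hxp, ht.gap_eq, sub_self] at this
    linarith
  · intro r hr heq σ hσ
    have hr0 : 0 ≤ r := htI.1.trans hr.1
    have hrI : r ∈ Icc 0 τ := ⟨hr0, hr.2.le⟩
    have hrτ : 0 < τ - r := by linarith [hr.2]
    have hpos : 0 < gap i j k (x r) := by
      rw [heq]
      have := mul_nonneg hA0.le (sq_nonneg (τ - r))
      linarith
    rcases H τ (τ - r) x hx τ hτ r hrI hxp (Or.inr rfl) hrτ.le (by linarith [hr.1]) σ hσ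
      with h3 | h3
    · have h1 := hC i j k P (x r) p (hx.bound r hrI) (hxp ▸ hx.bound τ hτ)
      have h2 : ‖x r - p‖ ≤ L * (τ - r) := by
        rw [norm_sub_rev, ← hxp]
        exact hx.norm_sub_le hr0 hr.2.le le_rfl
      have h4 : C * ‖x r - p‖ ≤ C * L * (τ - r) := by
        rw [mul_assoc]; gcongr
      have h6 := (abs_le.1 h1).1
      rw [h3.1]
      have : 2 * A * (τ - r) = C * L * (τ - r) + (τ - r) := by rw [hA]; ring
      linarith
    · exact absurd h3.2 (not_le.2 hpos)

/-! ### Negligible terminal sets -/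

lemma abs_gap_sub_le {n N : ℕ} {M : ℝ} {x y : St n N} (hx : ‖x‖ ≤ M) (hy : ‖y‖ ≤ M)
    (i j k : Fin N) : |gap i j k x - gap i j k y| ≤ 16 * M * ‖x - y‖ := by
  have hM : 0 ≤ M := (norm_nonneg x).trans hx
  have key : ∀ l, |‖x l - x i‖ ^ 2 - ‖y l - y i‖ ^ 2| ≤ 8 * M * ‖x - y‖ := by
    intro l
    have h1 : |‖x l - x i‖ - ‖y l - y i‖| ≤ 2 * ‖x - y‖ := by
      refine (abs_norm_sub_norm_le _ _).trans ?_
      have e : x l - x i - (y l - y i) = (x - y) l - (x - y) i := by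
        simp only [Pi.sub_apply]; abel
      rw [e]
      exact norm_relPos_apply_le l i (x - y)
    have h2 : ‖x l - x i‖ + ‖y l - y i‖ ≤ 4 * M := by
      linarith [norm_apply_sub_le hx l i, norm_apply_sub_le hy l i]
    rw [sq_sub_sq, abs_mul, abs_of_nonneg (by positivity)]
    calc _ ≤ 4 * M * (2 * ‖x - y‖) := by gcongr
      _ = _ := by ring
  have e : gap i j k x - gap i j k y =
      (‖x j - x i‖ ^ 2 - ‖y j - y i‖ ^ 2) - (‖x k - x i‖ ^ 2 - ‖y k - y i‖ ^ 2) := by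
    simp only [gap]; ring
  rw [e]
  exact (abs_sub _ _).trans (by linarith [key j, key k])

lemma continuous_gap {n N : ℕ} (i j k : Fin N) : Continuous (gap i j k : St n N → ℝ) :=
  continuous_iff_continuousAt.2 fun y => (hasStrictFDerivAt_gap i j k y).continuousAt

/-- The gap vanishes quadratically along every solution ending at `p`. -/
def QuadraticApproach {n N : ℕ} (a : ℝ → ℝ) (κ : ℕ) (M L : ℝ) (i j k : Fin N) (m : ℕ)
    (p : St n N) : Prop :=
  ∀ τ x, IsSelSol a κ M L τ x → x τ = p → ∀ t ∈ Icc 0 τ, τ - t < 1 / ((m : ℝ) + 1) →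
    |gap i j k (x t)| ≤ m * (τ - t) ^ 2

lemma exists_tie_of_not_locallyUnique {n N κ : ℕ} {a : ℝ → ℝ} {M L : ℝ}
    (h : Admissible n N κ a M L) {p : St n N} (hpM : ‖p‖ ≤ M) (hp : ¬ LocallyUnique a κ M L p) :
    ∃ i j k, j ≠ i ∧ k ≠ i ∧ j ≠ k ∧ gap i j k p = 0 ∧
      ((∃ i' j' k', j' ≠ i' ∧ k' ≠ i' ∧ j' ≠ k' ∧ gap i' j' k' p = 0 ∧
        ¬ (i' = i ∧ (j' = j ∧ k' = k ∨ j' = k ∧ k' = j))) ∨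
      ∃ m, QuadraticApproach a κ M L i j k m p) := by
  obtain ⟨i, S, S', hS, hS', hne⟩ : ∃ i S S', IsNbrSet κ p i S ∧ IsNbrSet κ p i S' ∧ S ≠ S' := by
    by_contra! hcon
    exact hp (locallyUnique_of_subsingleton h hcon)
  obtain ⟨j, k, hj, hk, hjk, hgap, hsimple⟩ := exists_simpleTie h.le_pred h.nonneg hS hS' hne
  refine ⟨i, j, k, hj, hk, hjk, hgap, or_iff_not_imp_left.2 fun hcon => ?_⟩
  push Not at hcon
  obtain ⟨P, Q, ht⟩ := hsimple fun i' j' k' h1 h2 h3 h4 => hcon i' j' k' h1 h2 h3 h4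
  have hQ : gapDeriv i j k p (frozen a Q p) ≤ 0 := by
    by_contra! hpos
    exact hp (ht.locallyUnique h hpM hpos)
  have hP : 0 ≤ gapDeriv i j k p (frozen a P p) := by
    by_contra! hneg
    exact hp (ht.swap.locallyUnique h hpM (by rw [gapDeriv_swap]; linarith))
  obtain ⟨C₁, δ₁, hδ₁, H₁⟩ := ht.exists_gap_le h hP
  obtain ⟨C₂, δ₂, hδ₂, H₂⟩ := ht.swap.exists_gap_le h (by rw [gapDeriv_swap]; linarith)
  obtain ⟨m, hm⟩ := exists_nat_gt (max (max C₁ C₂) (max (1 / δ₁) (1 / δ₂)))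
  simp only [max_lt_iff] at hm
  refine ⟨m, fun τ x hx hxp t ht htm => ?_⟩
  have hδ : ∀ δ > 0, 1 / δ < (m : ℝ) → 1 / ((m : ℝ) + 1) < δ := by
    intro δ hδ hm
    rw [div_lt_iff₀ hδ] at hm
    rw [div_lt_iff₀ (by positivity)]
    linarith
  have h1 := H₁ τ x hx hxp t ht (htm.trans (hδ δ₁ hδ₁ hm.2.1))
  have h2 := H₂ τ x hx hxp t ht (htm.trans (hδ δ₂ hδ₂ hm.2.2))
  rw [gap_swap] at h2
  have h3 := mul_le_mul_of_nonneg_right hm.1.1.le (sq_nonneg (τ - t))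
  have h4 := mul_le_mul_of_nonneg_right hm.1.2.le (sq_nonneg (τ - t))
  exact abs_le.2 ⟨by linarith, by linarith⟩

/-- The initial data whose uniqueness interval ends in `A` are negligible. -/
def TerminalNull {n N : ℕ} (a : ℝ → ℝ) (κ : ℕ) (M L : ℝ) (A : Set (St n N)) : Prop :=
  ∀ T, 0 ≤ T → volume {p | ∃ τ ∈ Icc 0 T, ∃ x, IsSelSol a κ M L τ x ∧ x 0 = p ∧
    UniqueUpTo a κ M L p τ ∧ x τ ∈ A} = 0

lemma TerminalNull.iUnion {n N κ : ℕ} {a : ℝ → ℝ} {M L : ℝ} {ι : Type*} [Countable ι]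
    {A : ι → Set (St n N)} (hA : ∀ l, TerminalNull a κ M L (A l)) :
    TerminalNull a κ M L (⋃ l, A l) := by
  intro T hT
  refine measure_mono_null ?_ (measure_iUnion_null fun l => hA l T hT)
  rintro p ⟨τ, hτ, x, hx, hxp, hun, hxA⟩
  obtain ⟨l, hl⟩ := mem_iUnion.1 hxA
  exact mem_iUnion.2 ⟨l, τ, hτ, x, hx, hxp, hun, hl⟩

lemma TerminalNull.mono {n N κ : ℕ} {a : ℝ → ℝ} {M L : ℝ} {A B : Set (St n N)}
    (hB : TerminalNull a κ M L B) (hAB : A ⊆ B) : TerminalNull a κ M L A := by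
  intro T hT
  refine measure_mono_null ?_ (hB T hT)
  rintro p ⟨τ, hτ, x, hx, hxp, hun, hxA⟩
  exact ⟨τ, hτ, x, hx, hxp, hun, hAB hxA⟩

lemma terminalNull_of_local {n N κ : ℕ} {a : ℝ → ℝ} {M L : ℝ} (h : Admissible n N κ a M L)
    {A : Set (St n N)} {ε₁ : ℝ} (hε₁ : 0 < ε₁) (W : ℝ → Set (St n N)) (hWo : ∀ ε, IsOpen (W ε))
    (hA : ∀ p ∈ A, ∃ O : Set (St n N), IsOpen O ∧ p ∈ O ∧ ∃ B : ℝ, ∀ ε, 0 < ε →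
      volume (O ∩ W ε) ≤ ENNReal.ofReal (B * ε ^ 2))
    (hW : ∀ τ x, IsSelSol a κ M L τ x → x τ ∈ A → ∀ ε, 0 < ε → ε < ε₁ → ∀ t ∈ Icc 0 τ,
      τ - t < ε → x t ∈ W ε) :
    TerminalNull a κ M L A := by
  have hL := h.speed_nonneg
  have hloc : ∀ p : A, ∃ ρ > 0, TerminalNull a κ M L (Metric.ball (p : St n N) ρ ∩ A) := by
    intro p
    obtain ⟨O, hO, hpO, B, hB⟩ := hA p p.2
    obtain ⟨ρ, hρ, hsub⟩ := Metric.isOpen_iff.1 hO p hpO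
    refine ⟨ρ / 2, half_pos hρ, fun T hT => ?_⟩
    refine volume_eq_zero_of_terminal h (B := B) (ε₀ := min ε₁ (ρ / (2 * (L + 1)))) hT
      (by positivity) (fun ε => O ∩ W ε) (fun ε _ _ => hO.inter (hWo ε)) (fun ε hε _ => hB ε hε) ?_
    rintro q ⟨τ, hτ, x, hx, hxq, hun, hxO, hxA⟩
    refine ⟨τ, hτ, x, hx, hxq, hun, fun ε hε hεlt t ht htε => ⟨hsub ?_, ?_⟩⟩
    · have h1 := hx.norm_sub_le ht.1 ht.2 le_rfl
      have h2 : ε * (2 * (L + 1)) < ρ := by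
        rw [← lt_div_iff₀ (by positivity)]
        exact hεlt.trans_le (min_le_right _ _)
      have h3 : L * (τ - t) ≤ L * ε := by gcongr
      have h4 : dist (x t) (x τ) < ρ / 2 := by
        rw [dist_comm, dist_eq_norm]
        linarith
      have h5 := dist_triangle (x t) (x τ) p
      rw [Metric.mem_ball] at hxO ⊢
      linarith
    · exact hW τ x hx hxA ε hε (hεlt.trans_le (min_le_left _ _)) t ht htε
  choose ρ hρ hnull using hloc
  obtain ⟨c, hc, hcover⟩ := TopologicalSpace.isOpen_iUnion_countable
    (fun p : A => Metric.ball (p : St n N) (ρ p)) fun p => Metric.isOpen_ball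
  have := hc.to_subtype
  refine (TerminalNull.iUnion (fun p : c => hnull p)).mono fun q hq => ?_
  have h1 : q ∈ ⋃ p : A, Metric.ball (p : St n N) (ρ p) :=
    mem_iUnion.2 ⟨⟨q, hq⟩, Metric.mem_ball_self (hρ _)⟩
  rw [← hcover] at h1
  obtain ⟨p, hp, hqp⟩ := mem_iUnion₂.1 h1
  exact mem_iUnion.2 ⟨⟨p, hp⟩, hqp, hq⟩

lemma terminalNull_quadraticApproach {n N κ : ℕ} {a : ℝ → ℝ} {M L : ℝ}
    (h : Admissible n N κ a M L) {i j k : Fin N} (hj : j ≠ i) (hk : k ≠ i) (hjk : j ≠ k) (m : ℕ) :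
    TerminalNull a κ M L
      {p : St n N | Function.Injective p ∧ QuadraticApproach a κ M L i j k m p} := by
  refine terminalNull_of_local h (ε₁ := 1 / ((m : ℝ) + 1)) (by positivity)
    (fun ε => {y | |gap i j k y| < (m + 1) * ε ^ 2})
    (fun ε => isOpen_lt (continuous_gap i j k).abs continuous_const) ?_ ?_
  · rintro p ⟨hp, -⟩
    obtain ⟨O, hO, hpO, B, hB⟩ := exists_isOpen_abs_gap_lt hp hj hk hjk
    refine ⟨O, hO, hpO, B * (m + 1), fun ε hε => (hB _ (by positivity)).trans_eq ?_⟩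
    rw [mul_assoc]
  · rintro τ x hx ⟨-, hq⟩ ε hε hε₁ t ht htε
    refine (hq τ x hx rfl t ht (htε.trans hε₁)).trans_lt ?_
    have h0 : 0 ≤ τ - t := by linarith [ht.2]
    have h1 : (m : ℝ) * (τ - t) ^ 2 ≤ m * ε ^ 2 := by gcongr
    have h2 : 0 < ε ^ 2 := by positivity
    linarith

lemma terminalNull_two_ties {n N κ : ℕ} {a : ℝ → ℝ} {M L : ℝ}
    (h : Admissible n N κ a M L) {i j k i' j' k' : Fin N} (hj : j ≠ i) (hk : k ≠ i) (hjk : j ≠ k)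
    (hj' : j' ≠ i') (hk' : k' ≠ i') (hjk' : j' ≠ k')
    (hne : ¬ (i' = i ∧ (j' = j ∧ k' = k ∨ j' = k ∧ k' = j))) :
    TerminalNull a κ M L
      {p : St n N | Function.Injective p ∧ gap i j k p = 0 ∧ gap i' j' k' p = 0} := by
  have hM := h.radius_nonneg
  have hL := h.speed_nonneg
  have hcoef : 0 < 16 * M * L + 1 := by positivity
  refine terminalNull_of_local h (ε₁ := 1) one_pos
    (fun ε => {y | |gap i j k y| < (16 * M * L + 1) * ε ∧ |gap i' j' k' y| < (16 * M * L + 1) * ε})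
    (fun ε => (isOpen_lt (continuous_gap i j k).abs continuous_const).inter
      (isOpen_lt (continuous_gap i' j' k').abs continuous_const)) ?_ ?_
  · rintro p ⟨hp, h0, h0'⟩
    obtain ⟨O, hO, hpO, B, hB⟩ :=
      exists_isOpen_abs_gap_lt_and hp hj hk hjk hj' hk' hjk' h0 h0' hne
    refine ⟨O, hO, hpO, B * (16 * M * L + 1) ^ 2, fun ε hε => (hB _ (by positivity)).trans_eq ?_⟩
    congr 1
    ring
  · rintro τ x hx ⟨-, h0, h0'⟩ ε hε - t ht htε
    have hlt : ∀ i j k : Fin N, gap i j k (x τ) = 0 →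
        |gap i j k (x t)| < (16 * M * L + 1) * ε := by
      intro i j k h0
      have h1 := abs_gap_sub_le (hx.bound t ht) (hx.bound τ ⟨ht.1.trans ht.2, le_rfl⟩) i j k
      rw [h0, sub_zero, norm_sub_rev] at h1
      have h2 := hx.norm_sub_le ht.1 ht.2 le_rfl
      have h3 : 16 * M * ‖x τ - x t‖ ≤ 16 * M * (L * ε) := by
        gcongr
        exact h2.trans (by gcongr)
      linarith
    exact ⟨hlt i j k h0, hlt i' j' k' h0'⟩

lemma terminalNull_not_locallyUnique {n N κ : ℕ} {a : ℝ → ℝ} {M L : ℝ}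
    (h : Admissible n N κ a M L) :
    TerminalNull a κ M L
      {p : St n N | ‖p‖ ≤ M ∧ Function.Injective p ∧ ¬ LocallyUnique a κ M L p} := by
  have h1 : TerminalNull a κ M L (⋃ t : {t : Fin N × Fin N × Fin N //
      t.2.1 ≠ t.1 ∧ t.2.2 ≠ t.1 ∧ t.2.1 ≠ t.2.2}, ⋃ m : ℕ, {p : St n N |
      Function.Injective p ∧ QuadraticApproach a κ M L t.1.1 t.1.2.1 t.1.2.2 m p}) :=
    .iUnion fun t => .iUnion fun m =>
      terminalNull_quadraticApproach h t.2.1 t.2.2.1 t.2.2.2 m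
  have h2 : TerminalNull a κ M L (⋃ t : {t : (Fin N × Fin N × Fin N) × Fin N × Fin N × Fin N //
      (t.1.2.1 ≠ t.1.1 ∧ t.1.2.2 ≠ t.1.1 ∧ t.1.2.1 ≠ t.1.2.2) ∧
      (t.2.2.1 ≠ t.2.1 ∧ t.2.2.2 ≠ t.2.1 ∧ t.2.2.1 ≠ t.2.2.2) ∧
      ¬ (t.2.1 = t.1.1 ∧ (t.2.2.1 = t.1.2.1 ∧ t.2.2.2 = t.1.2.2 ∨
        t.2.2.1 = t.1.2.2 ∧ t.2.2.2 = t.1.2.1))}, {p : St n N |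
      Function.Injective p ∧ gap t.1.1.1 t.1.1.2.1 t.1.1.2.2 p = 0 ∧
        gap t.1.2.1 t.1.2.2.1 t.1.2.2.2 p = 0}) :=
    .iUnion fun t => terminalNull_two_ties h t.2.1.1 t.2.1.2.1 t.2.1.2.2 t.2.2.1.1 t.2.2.1.2.1
      t.2.2.1.2.2 t.2.2.2
  refine (TerminalNull.iUnion (A := fun b : Bool => cond b _ _)
    (Bool.forall_bool.2 ⟨h1, h2⟩)).mono ?_
  rintro p ⟨hpM, hp, hnot⟩
  obtain ⟨i, j, k, hj, hk, hjk, h0, ⟨i', j', k', hj', hk', hjk', h0', hne⟩ | ⟨m, hm⟩⟩ :=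
    exists_tie_of_not_locallyUnique h hpM hnot
  · exact mem_iUnion.2 ⟨true, mem_iUnion.2
      ⟨⟨((i, j, k), (i', j', k')), ⟨hj, hk, hjk⟩, ⟨hj', hk', hjk'⟩, hne⟩, hp, h0, h0'⟩⟩
  · exact mem_iUnion.2 ⟨false, mem_iUnion.2 ⟨⟨(i, j, k), hj, hk, hjk⟩, mem_iUnion.2 ⟨m, hp, hm⟩⟩⟩

lemma volume_not_injective {n N : ℕ} (hn : 1 ≤ n) :
    volume {p : St n N | ¬ Function.Injective p} = 0 := by
  have hsub : {p : St n N | ¬ Function.Injective p} ⊆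
      ⋃ u : {u : Fin N × Fin N // u.1 ≠ u.2},
        ((relPos (n := n) u.1.1 u.1.2).ker : Set (St n N)) := by
    intro p hp
    obtain ⟨j, k, hjk, hne⟩ := Function.not_injective_iff.1 hp
    refine mem_iUnion.2 ⟨⟨(j, k), hne⟩, ?_⟩
    simp [hjk]
  refine measure_mono_null hsub (measure_iUnion_null fun u => ?_)
  refine Measure.addHaar_submodule _ _ fun htop => ?_
  have : Nonempty (Fin n) := ⟨⟨0, hn⟩⟩
  obtain ⟨w, hw⟩ := exists_ne (0 : EuclideanSpace ℝ (Fin n))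
  have h1 : Pi.single u.1.1 w ∈ (relPos (n := n) u.1.1 u.1.2).ker := htop ▸ Submodule.mem_top
  have h2 : relPos (n := n) u.1.1 u.1.2 (Pi.single u.1.1 w) = 0 := h1
  rw [relPos_apply, Pi.single_eq_same, Pi.single_eq_of_ne u.2.symm, sub_zero] at h2
  exact hw h2

lemma volume_not_unique_eq_zero {n N κ : ℕ} (hn : 1 ≤ n) (hκ : κ ≤ N - 1) {a : ℝ → ℝ} {K : ℝ≥0}
    (hK : LipschitzWith K a) (ha : ∀ r, 0 ≤ a r) :
    volume {p : St n N | ∃ T > (0 : ℝ), ∃ x y : ℝ → St n N, x 0 = p ∧ y 0 = p ∧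
      IsKrasovskySolutionOn (ft a κ) x (Icc 0 T) ∧ IsKrasovskySolutionOn (ft a κ) y (Icc 0 T) ∧
      ∃ t ∈ Icc (0 : ℝ) T, x t ≠ y t} = 0 := by
  choose L hL0 hL using fun m : ℕ => exists_frozen_bound (n := n) (N := N) hK.continuous (m + 1)
  have hadm : ∀ m : ℕ, Admissible n N κ a m (L m) := fun m =>
    ⟨hκ, ⟨K, hK⟩, ha, m.cast_nonneg, hL0 m, hL m⟩
  refine measure_mono_null ?_ (measure_union_null (volume_not_injective (N := N) hn)
    (measure_iUnion_null fun m : ℕ => terminalNull_not_locallyUnique (hadm m) m m.cast_nonneg))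
  rintro p ⟨T, hT, x, y, hxp, hyp, hx, hy, hne⟩
  by_cases hp : Function.Injective p
  swap
  · exact Or.inl hp
  right
  obtain ⟨Bx, hBx⟩ := isCompact_Icc.exists_bound_of_continuousOn hx.continuousOn
  obtain ⟨By, hBy⟩ := isCompact_Icc.exists_bound_of_continuousOn hy.continuousOn
  obtain ⟨m, hm⟩ := exists_nat_gt (max T (max Bx By))
  simp only [max_lt_iff] at hm
  have hx' := hx.isSelSol hκ hK.continuous (fun t ht => (hBx t ht).trans hm.2.1.le) (hL m)
  have hy' := hy.isSelSol hκ hK.continuous (fun t ht => (hBy t ht).trans hm.2.2.le) (hL m)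
  obtain ⟨τ, hτ, z, hz, hzp, hun, hterm⟩ := exists_terminal_of_not_unique hx' hy' hxp hyp hne
  have hττ : τ ∈ Icc 0 τ := ⟨hτ.1, le_rfl⟩
  exact mem_iUnion.2 ⟨m, τ, ⟨hτ.1, hτ.2.trans hm.1.le⟩, z, hz, hzp, hun, hz.bound τ hττ,
    hz.injective (hadm m) (hzp ▸ hp) hττ, hterm⟩

/-- The set of initial data from which the topological bounded-confidence model admits
more than one Krasovsky solution has zero Lebesgue measure. -/
theorem topological_krasovsky_ae_uniqueness (n N κ : ℕ) (hn : 1 ≤ n) (hN : 2 ≤ N)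
    (hκ₁ : 1 ≤ κ) (hκ₂ : κ ≤ N - 1) (a : ℝ → ℝ)
    (ha_lip : ∃ K : NNReal, LipschitzOnWith K a (Set.Ici 0))
    (ha_nonneg : ∀ r : ℝ, 0 ≤ r → 0 ≤ a r)
    (ha_pos : ∀ r : ℝ, 0 < r → 0 < a r)
    (ha_mono : MonotoneOn a (Set.Ici 0))
    :
    volume {xbar : St n N | ∃ T > (0:ℝ), ∃ x y : ℝ → St n N,
      x 0 = xbar ∧ y 0 = xbar ∧
      IsKrasovskySolutionOn (ft a κ) x (Set.Icc 0 T) ∧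
      IsKrasovskySolutionOn (ft a κ) y (Set.Icc 0 T) ∧
      ∃ t ∈ Set.Icc (0:ℝ) T, x t ≠ y t} = 0 := by

  obtain ⟨K, hK⟩ := ha_lip
  have hb : LipschitzWith (K * 1) fun r => a (max r 0) := by
    have h1 : LipschitzWith 1 fun r : ℝ => max r 0 := LipschitzWith.id.max_const 0
    have h2 := hK.comp (h1.lipschitzOnWith (s := univ)) fun r _ => mem_Ici.2 (le_max_right r 0)
    exact lipschitzOnWith_univ.1 h2
  have hft : (ft a κ : St n N → St n N) = ft (fun r => a (max r 0)) κ := by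
    funext x i
    simp only [ft, max_eq_left (norm_nonneg _)]
  rw [hft]
  exact volume_not_unique_eq_zero hn hκ₂ hb fun r => ha_nonneg _ (le_max_right r 0)
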